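/- For every integer j ≥ 2, there are infinitely many Carmichael numbers n such that the number of distinct prime factors of n is a perfect j-th power, i.e., ω(n) = m^j for some natural number m. (This statement is unconditional.) -/

import Mathlib

/-- A Carmichael number: a composite `n > 1` dividing `a^n - a` for every integer `a`. -/
def IsCarmichael (n : ℕ) : Prop :=
  1 < n ∧ ¬ n.Prime ∧ ∀ a : ℤ, (n : ℤ) ∣ a ^ n - a

section
lemma cpo_char_step {N M : ℕ} [NeZero N] (hM : 0 < M)
    (hexp : ∀ u : (ZMod N)ˣ, u ^ M = 1) (P : Finset ℕ) (hP : ∀ p ∈ P, p.Coprime N) :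
    ∃ a : ℕ → ℂ, (∀ p, a p ≠ 0) ∧
      ((Finset.univ.filter (fun χ : DirichletCharacter ℂ N => ∀ p ∈ P, χ (p : ZMod N) ≠ a p)).card : ℝ)
        ≤ (1 - 1 / (M : ℝ)) ^ P.card * (N.totient : ℝ) := by
  classical
  induction P using Finset.induction_on with
  | empty =>
    refine ⟨fun _ => 1, fun _ => one_ne_zero, ?_⟩
    simp [DirichletCharacter.card_eq_totient_of_hasEnoughRootsOfUnity, ← Nat.card_eq_fintype_card]
  | insert q P hq ih =>
    obtain ⟨a, ha0, ha⟩ := ih (fun p hp => hP p (Finset.mem_insert_of_mem hp))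
    set X := Finset.univ.filter (fun χ : DirichletCharacter ℂ N => ∀ p ∈ P, χ (p : ZMod N) ≠ a p) with hX
    have hqc : q.Coprime N := hP q (Finset.mem_insert_self _ _)
    have hroot : ∀ χ : DirichletCharacter ℂ N, χ (q : ZMod N) ∈ Polynomial.nthRootsFinset M (1 : ℂ) := by
      intro χ
      rw [Polynomial.mem_nthRootsFinset hM, ← map_pow, ← ZMod.coe_unitOfCoprime q hqc,
        ← Units.val_pow_eq_pow_val, hexp]
      simp
    have hcard : (Polynomial.nthRootsFinset M (1 : ℂ)).card ≤ M := by
      rw [Polynomial.nthRootsFinset_def]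
      exact (Multiset.toFinset_card_le _).trans (Polynomial.card_nthRoots _ _)
    have hne : (Polynomial.nthRootsFinset M (1 : ℂ)).Nonempty := ⟨_, hroot 1⟩
    obtain ⟨z, hz, hzc⟩ : ∃ z ∈ Polynomial.nthRootsFinset M (1 : ℂ),
        (X.card : ℝ) / M ≤ ((X.filter (fun χ => χ (q : ZMod N) = z)).card : ℝ) := by
      by_contra! hcon
      have h1 := Finset.card_eq_sum_card_fiberwise (s := X)
        (t := Polynomial.nthRootsFinset M (1 : ℂ)) (f := fun χ => χ (q : ZMod N)) (fun χ _ => hroot χ)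
      have h2 : (X.card : ℝ) < ∑ z ∈ Polynomial.nthRootsFinset M (1 : ℂ), (X.card : ℝ) / M := by
        calc (X.card : ℝ) = ∑ z ∈ Polynomial.nthRootsFinset M (1 : ℂ),
              ((X.filter (fun χ => χ (q : ZMod N) = z)).card : ℝ) := by exact_mod_cast h1
          _ < _ := Finset.sum_lt_sum_of_nonempty hne hcon
      rw [Finset.sum_const, nsmul_eq_mul] at h2
      have : ((Polynomial.nthRootsFinset M (1 : ℂ)).card : ℝ) * ((X.card : ℝ) / M) ≤ M * ((X.card : ℝ) / M) := by
        gcongr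
      rw [mul_div_cancel₀ _ (by positivity)] at this
      linarith
    refine ⟨Function.update a q z, ?_, ?_⟩
    · intro p
      by_cases hpq : p = q
      · subst hpq
        simp only [Function.update_self]
        rintro rfl
        rw [Polynomial.mem_nthRootsFinset hM] at hz
        simp [hM.ne'] at hz
      · simp [Function.update_of_ne hpq, ha0]
    · have hsub : (Finset.univ.filter (fun χ : DirichletCharacter ℂ N => ∀ p ∈ insert q P,
          χ (p : ZMod N) ≠ Function.update a q z p)) ⊆ X \ (X.filter (fun χ => χ (q : ZMod N) = z)) := by
        intro χ hχ
        simp only [Finset.mem_filter, Finset.mem_univ, true_and, Finset.mem_sdiff, hX] at hχ ⊢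
        have hX' : ∀ p ∈ P, χ (p : ZMod N) ≠ a p := by
          intro p hp
          have := hχ p (Finset.mem_insert_of_mem hp)
          rwa [Function.update_of_ne (by rintro rfl; exact hq hp)] at this
        refine ⟨hX', fun h => ?_⟩
        have := hχ q (Finset.mem_insert_self _ _)
        rw [Function.update_self] at this
        exact this h.2
      have h3 := Finset.card_le_card hsub
      have h4 := Finset.card_sdiff_add_card_eq_card (Finset.filter_subset (fun χ : DirichletCharacter ℂ N => χ (q : ZMod N) = z) X)
      have h5 : ((Finset.univ.filter (fun χ : DirichletCharacter ℂ N => ∀ p ∈ insert q P,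
          χ (p : ZMod N) ≠ Function.update a q z p)).card : ℝ) ≤ X.card - (X.card : ℝ) / M := by
        have h4' : ((X \ (X.filter (fun χ => χ (q : ZMod N) = z))).card : ℝ)
          + ((X.filter (fun χ => χ (q : ZMod N) = z)).card : ℝ) = X.card := by exact_mod_cast h4
        have h3' : ((Finset.univ.filter (fun χ : DirichletCharacter ℂ N => ∀ p ∈ insert q P,
          χ (p : ZMod N) ≠ Function.update a q z p)).card : ℝ) ≤ ((X \ (X.filter (fun χ => χ (q : ZMod N) = z))).card : ℝ) := by
          exact_mod_cast h3
        linarith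
      rw [Finset.card_insert_of_notMem hq, pow_succ]
      have hM1 : (0:ℝ) ≤ 1 - 1 / (M : ℝ) := by
        rw [sub_nonneg, div_le_one (by positivity)]
        exact_mod_cast hM
      calc _ ≤ (X.card : ℝ) - (X.card : ℝ) / M := h5
        _ = (1 - 1 / (M : ℝ)) * X.card := by ring
        _ ≤ (1 - 1 / (M : ℝ)) * ((1 - 1 / (M : ℝ)) ^ P.card * (N.totient : ℝ)) := by gcongr
        _ = _ := by ring

lemma exists_prod_one {N M e : ℕ} [NeZero N] (hM : 0 < M)
    (hexp : ∀ u : (ZMod N)ˣ, u ^ M = 1) (he : N.totient ≤ 2 ^ e)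
    (P : Finset ℕ) (hP : ∀ p ∈ P, p.Coprime N) (hc : M * e + 1 ≤ P.card) :
    ∃ S ⊆ P, S.Nonempty ∧ ((∏ p ∈ S, p : ℕ) : ZMod N) = 1 := by
  classical
  obtain ⟨a, ha0, ha⟩ := cpo_char_step hM hexp P hP
  have hMpos : (0:ℝ) < M := by exact_mod_cast hM
  have hM1 : (0:ℝ) ≤ 1 - 1 / (M : ℝ) := by
    rw [sub_nonneg, div_le_one (by positivity)]
    exact_mod_cast hM
  have hM2 : 1 - 1 / (M : ℝ) < 1 := by
    have : 0 < 1 / (M:ℝ) := by positivity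
    linarith
  have hlt : (1 - 1 / (M : ℝ)) ^ P.card * (N.totient : ℝ) < 1 := by
    have hpow : (1 - 1 / (M : ℝ)) ^ M ≤ 1 / 2 := by
      have h1 : (1 - 1 / (M : ℝ)) ≤ Real.exp (- (1 / (M:ℝ))) := by
        have := Real.add_one_le_exp (-(1 / (M:ℝ)))
        linarith
      calc (1 - 1 / (M : ℝ)) ^ M ≤ (Real.exp (- (1 / (M:ℝ)))) ^ M := by gcongr
        _ = Real.exp (-1) := by
          rw [← Real.exp_nat_mul]; congr 1; field_simp
        _ ≤ 1 / 2 := by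
          rw [Real.exp_neg, one_div]
          apply inv_anti₀ (by norm_num)
          have := Real.add_one_le_exp (1:ℝ)
          linarith
    have htot : (0:ℝ) < N.totient := by
      exact_mod_cast Nat.totient_pos.mpr (Nat.pos_of_ne_zero (NeZero.ne N))
    have he' : (N.totient : ℝ) ≤ 2 ^ e := by exact_mod_cast he
    calc (1 - 1 / (M : ℝ)) ^ P.card * (N.totient : ℝ)
        ≤ (1 - 1 / (M : ℝ)) ^ (M * e + 1) * N.totient := by
          gcongr ?_ * _
          exact pow_le_pow_of_le_one hM1 hM2.le hc
      _ = ((1 - 1 / (M : ℝ)) ^ M) ^ e * (1 - 1 / (M : ℝ)) * N.totient := by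
          rw [pow_succ, pow_mul]
      _ ≤ (1/2) ^ e * (1 - 1 / (M : ℝ)) * 2 ^ e := by gcongr
      _ = (1 - 1 / (M : ℝ)) := by
          rw [mul_right_comm, ← mul_pow]; norm_num
      _ < 1 := hM2
  have hzero : ∀ χ : DirichletCharacter ℂ N, ∃ p ∈ P, χ (p : ZMod N) = a p := by
    have hlt' : ((Finset.univ.filter (fun χ : DirichletCharacter ℂ N => ∀ p ∈ P, χ (p : ZMod N) ≠ a p)).card : ℝ) < 1 :=
      lt_of_le_of_lt ha hlt
    have h0 : (Finset.univ.filter (fun χ : DirichletCharacter ℂ N => ∀ p ∈ P, χ (p : ZMod N) ≠ a p)).card = 0 := by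
      have : (Finset.univ.filter (fun χ : DirichletCharacter ℂ N => ∀ p ∈ P, χ (p : ZMod N) ≠ a p)).card < 1 := by
        exact_mod_cast hlt'
      omega
    intro χ
    rw [Finset.card_eq_zero, Finset.filter_eq_empty_iff] at h0
    have := h0 (Finset.mem_univ χ)
    push Not at this
    exact this
  by_contra! hcon
  have hsum : ∑ χ : DirichletCharacter ℂ N, ∏ p ∈ P, (-χ (p : ZMod N) + a p) = 0 := by
    refine Finset.sum_eq_zero fun χ _ => ?_
    obtain ⟨p, hp, h⟩ := hzero χ
    exact Finset.prod_eq_zero hp (by rw [h]; ring)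
  simp_rw [Finset.prod_add] at hsum
  rw [Finset.sum_comm] at hsum
  have hterm : ∀ S ∈ P.powerset, S ≠ ∅ → ∑ χ : DirichletCharacter ℂ N,
      (∏ p ∈ S, (-χ (p : ZMod N))) * ∏ p ∈ P \ S, a p = 0 := by
    intro S hS hne
    rw [← Finset.sum_mul]
    have : ∀ χ : DirichletCharacter ℂ N, ∏ p ∈ S, (-χ (p : ZMod N)) = (-1) ^ S.card * χ ((∏ p ∈ S, p : ℕ) : ZMod N) := by
      intro χ
      push_cast
      rw [map_prod, Finset.prod_neg]
    simp_rw [this]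
    rw [← Finset.mul_sum, DirichletCharacter.sum_characters_eq]
    rw [if_neg (hcon S (Finset.mem_powerset.mp hS) (Finset.nonempty_iff_ne_empty.mpr hne))]
    simp
  rw [Finset.sum_eq_single ∅ hterm (by simp)] at hsum
  simp only [Finset.prod_empty, one_mul, Finset.sdiff_empty, Finset.sum_const, nsmul_eq_mul] at hsum
  rcases mul_eq_zero.mp hsum with h | h
  · rw [Nat.cast_eq_zero, Finset.card_eq_zero] at h
    exact absurd (Finset.mem_univ (1 : DirichletCharacter ℂ N)) (by rw [h]; simp)
  · exact Finset.prod_ne_zero_iff.mpr (fun p _ => ha0 p) h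

end

section
lemma carm_of_korselt (S : Finset ℕ) (hS : ∀ p ∈ S, p.Prime) (h2 : 2 ≤ S.card)
    (hd : ∀ p ∈ S, (p - 1) ∣ (∏ p ∈ S, p) - 1) :
    IsCarmichael (∏ p ∈ S, p) ∧ (∏ p ∈ S, p).primeFactors = S := by
  have hpf : (∏ p ∈ S, p).primeFactors = S := Nat.primeFactors_prod hS
  have hpos : 0 < ∏ p ∈ S, p := Finset.prod_pos fun p hp => (hS p hp).pos
  set n := ∏ p ∈ S, p with hn
  have hnp : ¬ n.Prime := by
    intro h
    rw [h.primeFactors] at hpf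
    rw [← hpf] at h2; simp at h2
  have h1 : 1 < n := by
    rcases Nat.lt_or_ge 1 n with h | h
    · exact h
    · exfalso
      interval_cases n
      simp at hpf
      rw [← hpf] at h2; simp at h2
  refine ⟨⟨h1, hnp, fun a => ?_⟩, hpf⟩
  rw [hn]; push_cast
  apply Finset.prod_dvd_of_coprime
  · intro p hp q hq hpq
    have := (Nat.coprime_primes (hS p hp) (hS q hq)).mpr hpq
    exact Nat.isCoprime_iff_coprime.mpr this
  · intro p hp
    haveI : Fact p.Prime := ⟨hS p hp⟩
    rw [← hn]
    rw [← ZMod.intCast_zmod_eq_zero_iff_dvd]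
    push_cast
    obtain ⟨c, hc⟩ := hd p hp
    by_cases ha : (a : ZMod p) = 0
    · rw [ha, zero_pow hpos.ne', sub_zero]
    · have : n = (p - 1) * c + 1 := by omega
      rw [this, pow_succ, pow_mul, ZMod.pow_card_sub_one_eq_one ha]
      simp

/-- greedy disjoint blocks -/
lemma exists_blocks (n0 : ℕ) (good : Finset ℕ → Prop) (P : Finset ℕ)
    (h : ∀ T ⊆ P, T.card = n0 → ∃ S ⊆ T, S.Nonempty ∧ good S) :
    ∀ B : ℕ, n0 * B ≤ P.card → ∃ f : ℕ → Finset ℕ,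
      (∀ i < B, f i ⊆ P ∧ (f i).Nonempty ∧ (f i).card ≤ n0 ∧ good (f i)) ∧
      ∀ i < B, ∀ j < B, i ≠ j → Disjoint (f i) (f j) := by
  intro B
  induction B with
  | zero => intro _; exact ⟨fun _ => ∅, by simp, by simp⟩
  | succ B ih =>
    intro hB
    obtain ⟨f, hf, hfd⟩ := ih (by nlinarith)
    set U := (Finset.range B).biUnion f with hU
    have hUc : U.card ≤ B * n0 := by
      calc U.card ≤ ∑ i ∈ Finset.range B, (f i).card := Finset.card_biUnion_le
        _ ≤ ∑ i ∈ Finset.range B, n0 := Finset.sum_le_sum fun i hi => (hf i (Finset.mem_range.mp hi)).2.2.1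
        _ = _ := by simp
    have hc : n0 ≤ (P \ U).card := by
      have := Finset.le_card_sdiff U P
      have h3 : n0 * (B+1) = B * n0 + n0 := by ring
      omega
    obtain ⟨T, hT, hTc⟩ := Finset.exists_subset_card_eq hc
    obtain ⟨S, hST, hSn, hSg⟩ := h T (hT.trans Finset.sdiff_subset) hTc
    have hdis : ∀ i < B, Disjoint (f i) S := by
      intro i hi
      refine Finset.disjoint_left.mpr fun x hx hxS => ?_
      have := hT (hST hxS)
      rw [Finset.mem_sdiff] at this
      exact this.2 (Finset.mem_biUnion.mpr ⟨i, Finset.mem_range.mpr hi, hx⟩)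
    refine ⟨Function.update f B S, ?_, ?_⟩
    · intro i hi
      rcases Nat.lt_succ_iff_lt_or_eq.mp hi with h1 | rfl
      · rw [Function.update_of_ne h1.ne]; exact hf i h1
      · rw [Function.update_self]
        exact ⟨(hST.trans hT).trans Finset.sdiff_subset, hSn, hTc ▸ Finset.card_le_card hST, hSg⟩
    · intro i hi j hj hij
      rcases Nat.lt_succ_iff_lt_or_eq.mp hi with h1 | rfl <;>
      rcases Nat.lt_succ_iff_lt_or_eq.mp hj with h2 | rfl
      · rw [Function.update_of_ne h1.ne, Function.update_of_ne h2.ne]; exact hfd i h1 j h2 hij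
      · rw [Function.update_of_ne h1.ne, Function.update_self]; exact hdis i h1
      · rw [Function.update_of_ne h2.ne, Function.update_self]; exact (hdis j h2).symm
      · exact absurd rfl hij

/-- A set with a perfect power cardinality. -/
lemma exists_power_block (n0 j : ℕ) (hj : 1 ≤ j) (good : Finset ℕ → Prop) (P : Finset ℕ)
    (hn0 : 0 < n0) (h : ∀ T ⊆ P, T.card = n0 → ∃ S ⊆ T, S.Nonempty ∧ good S)
    (hgood : ∀ (I : Finset ℕ) (f : ℕ → Finset ℕ), (∀ i ∈ I, good (f i)) →
      ((I : Set ℕ).PairwiseDisjoint f) → good (I.biUnion f))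
    (hP : 2 ^ j * n0 ^ (j + 1) ≤ P.card) :
    ∃ S ⊆ P, good S ∧ ∃ m, 2 ≤ m ∧ S.card = m ^ j := by
  obtain ⟨f, hf, hfd⟩ := exists_blocks n0 good P h (n0 * (2 ^ j * n0 ^ (j - 1))) (by
    refine le_trans (le_of_eq ?_) hP
    obtain ⟨k, rfl⟩ : ∃ k, j = k + 1 := ⟨j - 1, by omega⟩
    simp; ring)
  set B := n0 * (2 ^ j * n0 ^ (j - 1)) with hB
  obtain ⟨l, hl, hlc⟩ := Finset.exists_le_card_fiber_of_mul_le_card_of_maps_to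
    (s := Finset.range B) (t := Finset.Icc 1 n0) (f := fun i => (f i).card)
    (n := 2 ^ j * n0 ^ (j - 1)) (by
      intro i hi
      have := hf i (Finset.mem_range.mp hi)
      exact Finset.mem_Icc.mpr ⟨this.2.1.card_pos, this.2.2.1⟩) (by simp; omega) (by
      simp [hB])
  rw [Finset.mem_Icc] at hl
  have hle : 2 ^ j * l ^ (j - 1) ≤ ((Finset.range B).filter (fun i => (f i).card = l)).card :=
    le_trans (by gcongr; exact hl.2) hlc
  obtain ⟨I, hI, hIc⟩ := Finset.exists_subset_card_eq hle
  have hIB : ∀ i ∈ I, i < B ∧ (f i).card = l := by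
    intro i hi
    have := hI hi
    simpa using this
  have hpd : (I : Set ℕ).PairwiseDisjoint f := by
    intro i hi k hk hik
    exact hfd i (hIB i hi).1 k (hIB k hk).1 hik
  refine ⟨I.biUnion f, ?_, hgood I f (fun i hi => (hf i (hIB i hi).1).2.2.2) hpd, 2 * l, by omega, ?_⟩
  · exact Finset.biUnion_subset.mpr fun i hi => (hf i (hIB i hi).1).1
  · rw [Finset.card_biUnion hpd, Finset.sum_congr rfl (fun i hi => (hIB i hi).2), Finset.sum_const, hIc]
    obtain ⟨k, rfl⟩ : ∃ k, j = k + 1 := ⟨j - 1, by omega⟩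
    simp; ring

/-- From many primes `d*m+1`, `d ∣ L` to a Carmichael number. -/
lemma carm_from_primes {L M e j m : ℕ} (hL : 0 < L) (hj : 1 ≤ j) (hM : 0 < M) (hmL : m.Coprime L)
    (hexp : ∀ u : (ZMod L)ˣ, u ^ M = 1) (he : L.totient ≤ 2 ^ e) (P : Finset ℕ)
    (hP : ∀ p ∈ P, p.Prime ∧ p.Coprime L ∧ ∃ d, d ∣ L ∧ p = d * m + 1)
    (hc : 2 ^ j * (M * e + 1) ^ (j + 1) ≤ P.card) :
    ∃ S ⊆ P, S.Nonempty ∧ IsCarmichael (∏ p ∈ S, p) ∧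
      ∃ t, (∏ p ∈ S, p).primeFactors.card = t ^ j := by
  haveI : NeZero L := ⟨hL.ne'⟩
  obtain ⟨S, hSP, hSg, t, ht, hSt⟩ := exists_power_block (M * e + 1) j hj
    (fun S => ((∏ p ∈ S, p : ℕ) : ZMod L) = 1) P (by omega)
    (by
      intro T hT hTc
      obtain ⟨S, hS, hSn, h1⟩ := exists_prod_one hM hexp he T (fun p hp => (hP p (hT hp)).2.1) (by omega)
      exact ⟨S, hS, hSn, h1⟩)
    (by
      intro I f hg hd
      rw [Finset.prod_biUnion hd]
      push_cast
      refine Finset.prod_eq_one fun i hi => ?_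
      have := hg i hi
      push_cast at this
      exact this) hc
  have h2 : 2 ≤ S.card := by
    rw [hSt]; exact ht.trans (Nat.le_self_pow (by omega) t)
  have hpos : 0 < ∏ p ∈ S, p := Finset.prod_pos fun p hp => (hP p (hSP hp)).1.pos
  have hdiv : ∀ p ∈ S, (p - 1) ∣ (∏ p ∈ S, p) - 1 := by
    have hL1 : L ∣ (∏ p ∈ S, p) - 1 := by
      rw [← ZMod.natCast_eq_zero_iff, Nat.cast_sub hpos, hSg]; simp
    have hm1 : m ∣ (∏ p ∈ S, p) - 1 := by
      rw [← ZMod.natCast_eq_zero_iff, Nat.cast_sub hpos]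
      push_cast
      rw [Finset.prod_eq_one, sub_self]
      intro p hp
      obtain ⟨d, _, rfl⟩ := (hP p (hSP hp)).2.2
      simp
    have hmL1 : L * m ∣ (∏ p ∈ S, p) - 1 := hmL.symm.mul_dvd_of_dvd_of_dvd hL1 hm1
    intro p hp
    obtain ⟨d, hd, hpd⟩ := (hP p (hSP hp)).2.2
    refine dvd_trans ?_ hmL1
    rw [hpd]
    simpa using Nat.mul_dvd_mul_right hd m
  obtain ⟨hcarm, hpf⟩ := carm_of_korselt S (fun p hp => (hP p (hSP hp)).1) h2 hdiv
  exact ⟨S, hSP, Finset.card_pos.mp (by omega), hcarm, t, by rw [hpf, hSt]⟩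

end

section
open Complex

lemma cpow_sub_cpow_bound {x y : ℝ} (hx : 0 < x) (hxy : x ≤ y) {s : ℂ} (hs : 0 < s.re) :
    ‖(y : ℂ) ^ (-s) - (x : ℂ) ^ (-s)‖ ≤ ‖s‖ * x ^ (-s.re - 1) * (y - x) := by
  have hs0 : s ≠ 0 := by rintro rfl; simp at hs
  have h := Convex.norm_image_sub_le_of_norm_hasDerivWithin_le (𝕜 := ℝ)
    (f := fun t : ℝ => (t : ℂ) ^ (-s)) (f' := fun t => -s * (t : ℂ) ^ (-s - 1))
    (s := Set.Icc x y) (x := x) (y := y) (C := ‖s‖ * x ^ (-s.re - 1)) ?_ ?_ (convex_Icc x y)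
    ⟨le_rfl, hxy⟩ ⟨hxy, le_rfl⟩
  · rwa [Real.norm_of_nonneg (sub_nonneg.mpr hxy)] at h
  · intro t ht
    exact (hasDerivAt_ofReal_cpow_const (by linarith [ht.1]) (neg_ne_zero.mpr hs0)).hasDerivWithinAt
  · intro t ht
    have ht0 : 0 < t := lt_of_lt_of_le hx ht.1
    rw [norm_mul, norm_neg, norm_cpow_eq_rpow_re_of_pos ht0]
    gcongr
    simp only [sub_re, neg_re, one_re]
    exact Real.rpow_le_rpow_of_nonpos hx ht.1 (by linarith)

noncomputable def Lblk {N : ℕ} (χ : DirichletCharacter ℂ N) (m : ℕ) (s : ℂ) : ℂ :=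
  ∑ a ∈ Finset.range N, χ (a : ZMod N) *
    (((((m + 1) * N + a : ℕ) : ℝ) : ℂ) ^ (-s) - ((((m + 1) * N : ℕ) : ℝ) : ℂ) ^ (-s))

lemma Lblk_bound {N : ℕ} [NeZero N] (χ : DirichletCharacter ℂ N) (m : ℕ) {s : ℂ} (hs : 0 < s.re) :
    ‖Lblk χ m s‖ ≤ ‖s‖ * (N : ℝ) ^ (1 - s.re) * ((m : ℝ) + 1) ^ (-s.re - 1) := by
  have hN : (0:ℝ) < N := by exact_mod_cast Nat.pos_of_ne_zero (NeZero.ne N)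
  unfold Lblk
  calc _ ≤ ∑ a ∈ Finset.range N, ‖s‖ * (((m + 1) * N : ℕ) : ℝ) ^ (-s.re - 1) * N := by
        refine norm_sum_le_of_le _ fun a ha => ?_
        rw [norm_mul]
        have h1 := χ.norm_le_one (a : ZMod N)
        have ha' : (a : ℝ) ≤ N := by exact_mod_cast (Finset.mem_range.mp ha).le
        have h2 := cpow_sub_cpow_bound (x := (((m + 1) * N : ℕ) : ℝ)) (y := (((m + 1) * N + a : ℕ) : ℝ))
          (by push_cast; positivity) (by push_cast; linarith) hs
        have h3 : ‖s‖ * (((m + 1) * N : ℕ) : ℝ) ^ (-s.re - 1) *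
            ((((m + 1) * N + a : ℕ) : ℝ) - (((m + 1) * N : ℕ) : ℝ)) ≤
            ‖s‖ * (((m + 1) * N : ℕ) : ℝ) ^ (-s.re - 1) * N := by
          gcongr
          push_cast; linarith
        calc _ ≤ 1 * (‖s‖ * (((m + 1) * N : ℕ) : ℝ) ^ (-s.re - 1) * N) := by
              gcongr
              exact h2.trans h3
          _ = _ := one_mul _
    _ = _ := by
        rw [Finset.sum_const, Finset.card_range, nsmul_eq_mul]
        push_cast
        rw [Real.mul_rpow (by positivity) (by positivity)]
        have : (N:ℝ) ^ (1 - s.re) = N ^ (-s.re - 1) * N * N := by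
          rw [← Real.rpow_add_one hN.ne', ← Real.rpow_add_one hN.ne']
          congr 1; ring
        rw [this]; ring

noncomputable def Lfirst {N : ℕ} (χ : DirichletCharacter ℂ N) (s : ℂ) : ℂ :=
  ∑ a ∈ Finset.range N, χ (a : ZMod N) * (((a : ℕ) : ℝ) : ℂ) ^ (-s)

lemma sum_range_zmod {N : ℕ} [NeZero N] (f : ZMod N → ℂ) :
    ∑ a ∈ Finset.range N, f (a : ZMod N) = ∑ j : ZMod N, f j := by
  refine Finset.sum_bij (fun a _ => (a : ZMod N)) (by simp) ?_ ?_ (by simp)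
  · intro a ha b hb h
    rw [ZMod.natCast_eq_natCast_iff'] at h
    rwa [Nat.mod_eq_of_lt (Finset.mem_range.mp ha), Nat.mod_eq_of_lt (Finset.mem_range.mp hb)] at h
  · intro j _
    exact ⟨j.val, Finset.mem_range.mpr (ZMod.val_lt j), ZMod.natCast_zmod_val j⟩

lemma LFunction_eq_blk_of_one_lt {N : ℕ} [NeZero N] {χ : DirichletCharacter ℂ N} (hχ : χ ≠ 1)
    {s : ℂ} (hs : 1 < s.re) : χ.LFunction s = Lfirst χ s + ∑' m, Lblk χ m s := by
  have hs0 : s ≠ 0 := by rintro rfl; simp at hs; linarith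
  set F : ℕ → ℂ := fun n => χ (n : ZMod N) * (((n : ℕ) : ℝ) : ℂ) ^ (-s) with hF
  have hterm : LSeries.term (fun n => χ (n : ZMod N)) s = F := by
    ext n
    rcases eq_or_ne n 0 with rfl | hn
    · simp [hF, hs0]
    · rw [LSeries.term_of_ne_zero hn, hF, div_eq_mul_inv, ← cpow_neg]; simp
  have hsum : Summable F := by
    rw [← hterm]; exact χ.LSeriesSummable_of_one_lt_re hs
  rw [χ.LFunction_eq_LSeries hs, LSeries, hterm, Nat.sumByResidueClasses hsum N]
  have hsumj : ∀ j : ℕ, Summable fun m => F (j + N * m) := by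
    intro j
    refine hsum.comp_injective ?_
    intro a b h
    have := NeZero.ne N
    simpa [this] using h
  have h1 : ∑ j : ZMod N, ∑' m : ℕ, F (j.val + N * m) = ∑ a ∈ Finset.range N, ∑' m : ℕ, F (a + N * m) := by
    rw [← sum_range_zmod (fun j => ∑' m : ℕ, F (j.val + N * m))]
    refine Finset.sum_congr rfl fun a ha => ?_
    rw [ZMod.val_natCast, Nat.mod_eq_of_lt (Finset.mem_range.mp ha)]
  rw [h1, ← Summable.tsum_finsetSum (fun a _ => hsumj a)]
  have hsumS : Summable fun m => ∑ a ∈ Finset.range N, F (a + N * m) := summable_sum fun a _ => hsumj a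
  rw [hsumS.tsum_eq_zero_add]
  congr 1
  · refine tsum_congr fun m => ?_
    have h0 : ∑ a ∈ Finset.range N, χ (a : ZMod N) = 0 := by
      rw [sum_range_zmod (fun j => χ j)]; exact MulChar.sum_eq_zero_of_ne_one hχ
    unfold Lblk
    simp_rw [mul_sub]
    rw [Finset.sum_sub_distrib, ← Finset.sum_mul, h0, zero_mul, sub_zero]
    refine Finset.sum_congr rfl fun a _ => ?_
    simp only [hF]
    have e1 : ((a + N * (m + 1) : ℕ) : ZMod N) = a := by simp
    have e2 : a + N * (m + 1) = (m + 1) * N + a := by ring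
    rw [e1, e2]

lemma Lblk_diff {N : ℕ} [NeZero N] (χ : DirichletCharacter ℂ N) (m : ℕ) : Differentiable ℂ (Lblk χ m) := by
  unfold Lblk
  have hN : (N:ℂ) ≠ 0 := by exact_mod_cast NeZero.ne N
  have hne : ∀ k : ℕ, k ≠ 0 → Differentiable ℂ (fun s : ℂ => (((k : ℕ) : ℝ) : ℂ) ^ (-s)) := by
    intro k hk
    exact (differentiable_neg).const_cpow (Or.inl (by simpa using hk))
  have h0 : (m+1) * N ≠ 0 := mul_ne_zero (by omega) (NeZero.ne N)
  refine Differentiable.fun_sum fun a _ => ?_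
  exact ((hne _ (by omega)).sub (hne _ h0)).const_mul _

lemma Lfirst_diff {N : ℕ} [NeZero N] {χ : DirichletCharacter ℂ N} (hχ : χ ≠ 1) : Differentiable ℂ (Lfirst χ) := by
  unfold Lfirst
  refine Differentiable.fun_sum fun a _ => ?_
  rcases eq_or_ne a 0 with rfl | ha
  · have : Nontrivial (ZMod N) := by
      by_contra h
      rw [not_nontrivial_iff_subsingleton] at h
      have hN := ZMod.subsingleton_iff.mp h
      subst hN
      exact hχ (DirichletCharacter.level_one χ)
    simp [MulChar.map_zero]
  · exact ((differentiable_neg).const_cpow (Or.inl (by simpa using ha))).const_mul _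

lemma LFunction_eq_blk {N : ℕ} [NeZero N] {χ : DirichletCharacter ℂ N} (hχ : χ ≠ 1)
    {s : ℂ} (hs : s ∈ Metric.ball (2 : ℂ) (3/2)) : χ.LFunction s = Lfirst χ s + ∑' m, Lblk χ m s := by
  have hN1 : (1:ℝ) ≤ N := by exact_mod_cast Nat.one_le_iff_ne_zero.mpr (NeZero.ne N)
  have hre : ∀ s ∈ Metric.ball (2 : ℂ) (3/2), 1/2 ≤ s.re ∧ ‖s‖ ≤ 7/2 := by
    intro s hs
    rw [mem_ball_iff_norm] at hs
    have h1 := (abs_re_le_norm (s - 2)).trans hs.le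
    simp only [sub_re, re_ofNat] at h1
    have h2 := norm_add_le (s - 2) 2
    simp at h2
    rw [abs_le] at h1
    constructor <;> linarith [h1.1]
  have hT : DifferentiableOn ℂ (fun s => ∑' m, Lblk χ m s) (Metric.ball (2 : ℂ) (3/2)) := by
    refine differentiableOn_tsum_of_summable_norm
      (u := fun m : ℕ => 7/2 * (N : ℝ) ^ (1/2 : ℝ) * ((m : ℝ) + 1) ^ (-(3/2) : ℝ)) ?_
      (fun m => (Lblk_diff χ m).differentiableOn) Metric.isOpen_ball ?_
    · refine Summable.mul_left _ ?_
      have := (summable_nat_add_iff 1).mpr (Real.summable_nat_rpow (p := -(3/2)) |>.mpr (by norm_num))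
      simpa using this
    · intro m w hw
      obtain ⟨h1, h2⟩ := hre w hw
      refine (Lblk_bound χ m (by linarith)).trans ?_
      gcongr
      · linarith
      · linarith
      · linarith
  have hA := (DifferentiableOn.analyticOnNhd (χ.differentiable_LFunction hχ).differentiableOn
    Metric.isOpen_ball (s := Metric.ball (2 : ℂ) (3/2)))
  have hB := (DifferentiableOn.analyticOnNhd ((Lfirst_diff hχ).differentiableOn.add hT) Metric.isOpen_ball)
  refine hA.eqOn_of_preconnected_of_eventuallyEq hB (convex_ball _ _).isPreconnected
    (z₀ := 2) (by simp) ?_ hs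
  have : {s : ℂ | 1 < s.re} ∈ nhds (2:ℂ) := (isOpen_lt continuous_const continuous_re).mem_nhds (by simp)
  filter_upwards [this] with w hw
  exact LFunction_eq_blk_of_one_lt hχ hw


lemma rpow_le_two_mul_rpow {x ℓ σ : ℝ} (hx : 1 ≤ x) (hℓ : 1 ≤ ℓ) (hl : Real.log x ≤ ℓ)
    (hσ : |σ| ≤ 1 / (2 * ℓ)) : x ^ σ ≤ 2 := by
  have h0 : 0 ≤ Real.log x := Real.log_nonneg hx
  rw [Real.rpow_def_of_pos (by linarith)]
  have h1 : Real.log x * σ ≤ 1 / 2 := by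
    calc Real.log x * σ ≤ Real.log x * |σ| := by gcongr; exact le_abs_self σ
      _ ≤ ℓ * (1 / (2 * ℓ)) := by gcongr
      _ = 1 / 2 := by field_simp
  have h2 : Real.exp (1/2) ≤ 2 := by
    have h4 : Real.exp (1/2) ^ 2 = Real.exp 1 := by
      rw [← Real.exp_nat_mul]; norm_num
    have h3 := Real.exp_one_lt_d9
    nlinarith [Real.exp_pos (1/2)]
  exact (Real.exp_le_exp.mpr h1).trans h2

lemma LFunction_near_one_bound : ∃ C : ℝ, 1 ≤ C ∧ ∀ (N : ℕ) [NeZero N] (χ : DirichletCharacter ℂ N),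
    χ ≠ 1 → ∀ ℓ : ℝ, 1 ≤ ℓ → Real.log N ≤ ℓ → ∀ s : ℂ, ‖s - 1‖ ≤ 1 / (4 * ℓ) →
    ‖χ.LFunction s‖ ≤ C * ℓ := by
  set Z : ℝ := ∑' m : ℕ, ((m : ℝ) + 1) ^ (-(3/2) : ℝ) with hZ
  have hZs : Summable fun m : ℕ => ((m : ℝ) + 1) ^ (-(3/2) : ℝ) := by
    have := (summable_nat_add_iff 1).mpr (Real.summable_nat_rpow (p := -(3/2)) |>.mpr (by norm_num))
    simpa using this
  have hZ0 : 0 ≤ Z := tsum_nonneg fun m => by positivity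
  refine ⟨4 + 4 * Z, by linarith, ?_⟩
  intro N _ χ hχ ℓ hℓ hN s hs
  have hN1 : (1:ℝ) ≤ N := by exact_mod_cast Nat.one_le_iff_ne_zero.mpr (NeZero.ne N)
  have hq : 1 / (4 * ℓ) ≤ 1 / 4 := by
    apply one_div_le_one_div_of_le <;> linarith
  have hs4 : ‖s - 1‖ ≤ 1/4 := hs.trans hq
  have hre := (abs_re_le_norm (s - 1)).trans hs
  have hre4 := (abs_re_le_norm (s - 1)).trans hs4
  simp only [sub_re, one_re] at hre hre4
  rw [abs_le] at hre4
  have hns : ‖s‖ ≤ 2 := by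
    have h2 := norm_add_le (s - 1) 1
    simp at h2; linarith
  have hσ : |1 - s.re| ≤ 1 / (2 * ℓ) := by
    rw [abs_sub_comm]; refine hre.trans ?_
    apply one_div_le_one_div_of_le <;> linarith
  have hs0 : s ≠ 0 := by rintro rfl; simp at hs4; linarith
  rw [LFunction_eq_blk hχ (by
    rw [mem_ball_iff_norm]
    have h2 := norm_sub_le (s - 1) 1
    have : s - 1 - 1 = s - 2 := by ring
    rw [this] at h2; simp at h2; linarith)]
  have hfirst : ‖Lfirst χ s‖ ≤ 4 * ℓ := by
    unfold Lfirst
    calc _ ≤ ∑ a ∈ Finset.range N, 2 * ((a : ℝ))⁻¹ := by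
          refine norm_sum_le_of_le _ fun a ha => ?_
          rcases eq_or_ne a 0 with rfl | ha0
          · simp [hs0]
          have ha1 : (1:ℝ) ≤ a := by exact_mod_cast Nat.one_le_iff_ne_zero.mpr ha0
          rw [norm_mul, norm_cpow_eq_rpow_re_of_pos (by linarith)]
          have h3 : (a:ℝ) ^ (-s).re = a ^ (1 - s.re) * (a:ℝ)⁻¹ := by
            rw [← Real.rpow_neg_one, ← Real.rpow_add (by linarith)]; congr 1; simp; ring
          rw [h3]
          have h4 : (a:ℝ) ^ (1 - s.re) ≤ 2 := rpow_le_two_mul_rpow ha1 hℓ (by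
            refine le_trans ?_ hN
            apply Real.log_le_log (by linarith)
            exact_mod_cast (Finset.mem_range.mp ha).le) hσ
          calc _ ≤ 1 * (2 * (a:ℝ)⁻¹) := by
                gcongr
                exact χ.norm_le_one _
            _ = _ := one_mul _
      _ ≤ 2 * (1 + Real.log N) := by
          rw [← Finset.mul_sum]
          gcongr
          refine le_trans ?_ (harmonic_le_one_add_log N)
          unfold harmonic
          push_cast
          rw [← Nat.sub_add_cancel (Nat.one_le_iff_ne_zero.mpr (NeZero.ne N)), Finset.sum_range_succ']
          simp only [Nat.cast_zero, inv_zero, add_zero]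
          rw [Finset.sum_range_succ]
          push_cast
          have : (0:ℝ) ≤ ((((N - 1 : ℕ)) : ℝ) + 1)⁻¹ := by positivity
          linarith
      _ ≤ _ := by linarith
  have hblk : ‖∑' m, Lblk χ m s‖ ≤ 4 * Z := by
    refine tsum_of_norm_bounded (hZs.hasSum.mul_left 4) fun m => ?_
    refine (Lblk_bound χ m (by linarith)).trans ?_
    have h4 : (N:ℝ) ^ (1 - s.re) ≤ 2 := rpow_le_two_mul_rpow hN1 hℓ hN hσ
    have h5 : ((m:ℝ)+1) ^ (-s.re - 1) ≤ ((m:ℝ)+1) ^ (-(3/2) : ℝ) :=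
      Real.rpow_le_rpow_of_exponent_le (by linarith [Nat.cast_nonneg (α := ℝ) m]) (by linarith)
    have h6 : ‖s‖ * (N:ℝ) ^ (1 - s.re) ≤ 2 * 2 := by gcongr
    calc _ ≤ 2 * 2 * ((m:ℝ)+1) ^ (-(3/2) : ℝ) := by gcongr
      _ = _ := by ring
  calc _ ≤ 4 * ℓ + 4 * Z := (norm_add_le _ _).trans (add_le_add hfirst hblk)
    _ ≤ 4 * ℓ + 4 * Z * ℓ := by nlinarith
    _ = _ := by ring

end

section
open Complex DirichletCharacter

lemma TrivChar₁_eq (N : ℕ) [NeZero N] (s : ℂ) : LFunctionTrivChar₁ N s =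
    (∏ p ∈ N.primeFactors, (1 - (p : ℂ) ^ (-s))) * LFunctionTrivChar₁ 1 s := by
  rcases eq_or_ne s 1 with rfl | hs
  · simp [LFunctionTrivChar₁, cpow_neg_one]
  · rw [LFunctionTrivChar₁, LFunctionTrivChar₁, Function.update_of_ne hs, Function.update_of_ne hs,
      LFunctionTrivChar_eq_mul_riemannZeta hs, LFunctionTrivChar_eq_mul_riemannZeta hs]
    simp; ring

lemma TrivChar₁_bound : ∃ C : ℝ, 1 ≤ C ∧ ∀ (N : ℕ) [NeZero N],
    ∑ p ∈ N.primeFactors, 1 / ((p : ℝ) - 1) ≤ 1/4 → 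
    ∀ ℓ : ℝ, 1 ≤ ℓ → Real.log N ≤ ℓ → ∀ s : ℂ, ‖s - 1‖ ≤ 1 / (4 * ℓ) →
    ‖LFunctionTrivChar₁ N s‖ ≤ C := by
  obtain ⟨C, hC⟩ := (isCompact_closedBall (1 : ℂ) 1).exists_bound_of_continuousOn
    (differentiable_LFunctionTrivChar₁ 1).continuous.continuousOn
  refine ⟨2 * max C 1, by linarith [le_max_right C 1], ?_⟩
  intro N _ hsum ℓ hℓ hN s hs
  have hq : 1 / (4 * ℓ) ≤ 1 := by
    rw [div_le_one] <;> linarith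
  rw [TrivChar₁_eq, norm_mul]
  have h1 := (hC s (by rw [mem_closedBall_iff_norm]; linarith)).trans (le_max_left C 1)
  have hre := (abs_re_le_norm (s - 1)).trans hs
  simp only [sub_re, one_re] at hre
  have hσ : |1 - s.re| ≤ 1 / (2 * ℓ) := by
    rw [abs_sub_comm]; refine hre.trans ?_
    apply one_div_le_one_div_of_le <;> linarith
  have h2 : ‖∏ p ∈ N.primeFactors, (1 - (p : ℂ) ^ (-s))‖ ≤ 2 := by
    rw [norm_prod]
    calc _ ≤ ∏ p ∈ N.primeFactors, (1 + 2 * (1 / ((p : ℝ) - 1))) := by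
          refine Finset.prod_le_prod (fun _ _ => norm_nonneg _) fun p hp => ?_
          have hp2 : (2:ℝ) ≤ p := by exact_mod_cast (Nat.prime_of_mem_primeFactors hp).two_le
          refine (norm_sub_le _ _).trans ?_
          rw [norm_one, ← ofReal_natCast, norm_cpow_eq_rpow_re_of_pos (by linarith)]
          have h3 : (p:ℝ) ^ (-s).re = p ^ (1 - s.re) * (p:ℝ)⁻¹ := by
            rw [← Real.rpow_neg_one, ← Real.rpow_add (by linarith)]; congr 1; simp; ring
          rw [h3]
          have h4 : (p:ℝ) ^ (1 - s.re) ≤ 2 := rpow_le_two_mul_rpow (by linarith) hℓ (by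
            refine le_trans ?_ hN
            apply Real.log_le_log (by linarith)
            exact_mod_cast Nat.le_of_mem_primeFactors hp) hσ
          rw [inv_eq_one_div]
          gcongr
          · linarith
          · linarith
      _ ≤ Real.exp (∑ p ∈ N.primeFactors, 2 * (1 / ((p : ℝ) - 1))) := by
          rw [Real.exp_sum]
          refine Finset.prod_le_prod (fun p hp => ?_) fun p hp => ?_
          · have hp2 : (2:ℝ) ≤ p := by exact_mod_cast (Nat.prime_of_mem_primeFactors hp).two_le
            have : 0 ≤ (p:ℝ) - 1 := by linarith
            positivity
          · rw [add_comm]; exact Real.add_one_le_exp _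
      _ ≤ Real.exp (1/2) := by
          rw [Real.exp_le_exp, ← Finset.mul_sum]; linarith
      _ ≤ 2 := by
        have h4 : Real.exp (1/2) ^ 2 = Real.exp 1 := by
          rw [← Real.exp_nat_mul]; norm_num
        have h3 := Real.exp_one_lt_d9
        nlinarith [Real.exp_pos (1/2)]
  gcongr

lemma TrivChar₁_one (N : ℕ) [NeZero N] (hsum : ∑ p ∈ N.primeFactors, 1 / ((p : ℝ) - 1) ≤ 1/4) :
    3/4 ≤ ‖LFunctionTrivChar₁ N 1‖ := by
  have key : ∀ S : Finset ℕ, (∀ p ∈ S, 2 ≤ p) →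
      1 - ∑ p ∈ S, 1 / ((p : ℝ) - 1) ≤ ∏ p ∈ S, ‖(1 - (p : ℂ)⁻¹)‖ := by
    intro S
    induction S using Finset.induction_on with
    | empty => simp
    | insert p S hp ih =>
      intro h
      rw [Finset.sum_insert hp, Finset.prod_insert hp]
      have h1 := ih fun q hq => h q (Finset.mem_insert_of_mem hq)
      have hp2 : (2:ℝ) ≤ p := by exact_mod_cast h p (Finset.mem_insert_self _ _)
      have h2 : ‖(1 - (p : ℂ)⁻¹)‖ = 1 - (p:ℝ)⁻¹ := by
        have : (1 - (p : ℂ)⁻¹) = ((1 - (p:ℝ)⁻¹ : ℝ) : ℂ) := by push_cast; rfl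
        rw [this, norm_real, Real.norm_of_nonneg]
        have : (p:ℝ)⁻¹ ≤ 1 := inv_le_one_of_one_le₀ (by linarith)
        linarith
      have h3 : (p:ℝ)⁻¹ ≤ 1 / ((p:ℝ) - 1) := by
        rw [inv_eq_one_div]; apply one_div_le_one_div_of_le <;> linarith
      have h4 : ∏ p ∈ S, ‖(1 - (p : ℂ)⁻¹)‖ ≤ 1 := by
        refine Finset.prod_le_one (fun _ _ => norm_nonneg _) fun q hq => ?_
        have hq2 : (2:ℝ) ≤ q := by exact_mod_cast h q (Finset.mem_insert_of_mem hq)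
        have h2 : ‖(1 - (q : ℂ)⁻¹)‖ = 1 - (q:ℝ)⁻¹ := by
          have : (1 - (q : ℂ)⁻¹) = ((1 - (q:ℝ)⁻¹ : ℝ) : ℂ) := by push_cast; rfl
          rw [this, norm_real, Real.norm_of_nonneg]
          have : (q:ℝ)⁻¹ ≤ 1 := inv_le_one_of_one_le₀ (by linarith)
          linarith
        rw [h2]; have : 0 ≤ (q:ℝ)⁻¹ := by positivity
        linarith
      have h5 : 0 ≤ (p:ℝ)⁻¹ := by positivity
      rw [h2]
      nlinarith
  have h := key N.primeFactors fun p hp => (Nat.prime_of_mem_primeFactors hp).two_le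
  simp only [LFunctionTrivChar₁, Function.update_self, norm_prod]
  linarith

lemma dist_one_bound {f : ℂ → ℂ} (hf : Differentiable ℂ f) {ρ B : ℝ} (hρ : 0 < ρ)
    (hB : ∀ s, ‖s - 1‖ ≤ ρ → ‖f s‖ ≤ B) : 
    ∀ s, ‖s - 1‖ ≤ ρ/2 → ‖deriv f s‖ ≤ 2 * B / ρ ∧ ‖f s - f 1‖ ≤ 2 * B / ρ * ‖s - 1‖ := by
  have h : ∀ s, ‖s - 1‖ ≤ ρ/2 → ‖deriv f s‖ ≤ 2 * B / ρ := by
    intro s hs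
    have := norm_deriv_le_of_forall_mem_sphere_norm_le (c := s) (R := ρ/2) (C := B) (f := f)
      (by linarith) hf.diffContOnCl (fun z hz => hB z (by
        rw [mem_sphere_iff_norm] at hz
        have := norm_add_le (z - s) (s - 1)
        rw [sub_add_sub_cancel] at this
        linarith))
    calc _ ≤ _ := this
      _ = _ := by field_simp
  intro s hs
  refine ⟨h s hs, ?_⟩
  refine Convex.norm_image_sub_le_of_norm_deriv_le (𝕜 := ℂ) (s := Metric.closedBall 1 (ρ/2))
    (fun x _ => hf x) (fun x hx => h x (by rwa [mem_closedBall_iff_norm] at hx))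
    (convex_closedBall _ _) (by simp; linarith) (by rwa [mem_closedBall_iff_norm])

lemma logDeriv_one_bound {f : ℂ → ℂ} (hf : Differentiable ℂ f) {ρ B δ η : ℝ} (hρ : 0 < ρ)
    (hB : ∀ s, ‖s - 1‖ ≤ ρ → ‖f s‖ ≤ B) (hδ : 0 < δ) (h1 : δ ≤ ‖f 1‖) (hη : 0 < η)
    (hη1 : η ≤ ρ/2) (hη2 : η * (2 * B / ρ) ≤ δ/2) :
    ∀ s, ‖s - 1‖ ≤ η → f s ≠ 0 ∧ ‖deriv f s / f s‖ ≤ 1/η := by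
  intro s hs
  obtain ⟨h2, h3⟩ := dist_one_bound hf hρ hB s (hs.trans hη1)
  have hB0 : 0 ≤ 2 * B / ρ := le_trans (norm_nonneg _) h2
  have h4 : ‖f s - f 1‖ ≤ δ/2 := by
    refine h3.trans (le_trans ?_ hη2)
    rw [mul_comm]; gcongr
  have h5 : δ/2 ≤ ‖f s‖ := by
    have := norm_sub_norm_le (f 1) (f s)
    rw [norm_sub_rev] at this; linarith
  refine ⟨by rw [← norm_pos_iff]; linarith, ?_⟩
  rw [norm_div, div_le_div_iff₀ (by linarith) hη]
  nlinarith

lemma re_log_comb3 {a : ℝ} (ha₀ : 0 ≤ a) (ha₁ : a < 1) {z w : ℂ} (hz : ‖z‖ = 1) (hw : ‖w‖ = 1) :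
      0 ≤ 3 * (-log (1 - a)).re + 2 * (-log (1 - a * z)).re + 2 * (-log (1 - a * w)).re
        + 2 * (-log (1 - a * (z * w⁻¹))).re := by
  have hac₀ : ‖(a : ℂ)‖ < 1 := by
    simp only [Complex.norm_of_nonneg ha₀, ha₁]
  have hac₁ : ‖a * z‖ < 1 := by rwa [norm_mul, hz, mul_one]
  have hac₂ : ‖a * w‖ < 1 := by rwa [norm_mul, hw, mul_one]
  have hac₃ : ‖a * (z * w⁻¹)‖ < 1 := by rwa [norm_mul, norm_mul, norm_inv, hz, hw, inv_one, mul_one, mul_one]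
  rw [← (((hasSum_re <| hasSum_taylorSeries_neg_log hac₀).mul_left 3).add
    ((hasSum_re <| hasSum_taylorSeries_neg_log hac₁).mul_left 2) |>.add
    ((hasSum_re <| hasSum_taylorSeries_neg_log hac₂).mul_left 2) |>.add
    ((hasSum_re <| hasSum_taylorSeries_neg_log hac₃).mul_left 2)).tsum_eq]
  refine tsum_nonneg fun n ↦ ?_
  simp only [← ofReal_pow, div_natCast_re, ofReal_re, mul_pow, re_ofReal_mul]
  rcases n.eq_zero_or_pos with rfl | hn
  · simp
  · simp only [← mul_div_assoc, ← add_div]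
    refine div_nonneg ?_ n.cast_nonneg
    have hz' : ‖z ^ n‖ = 1 := by rw [norm_pow, hz, one_pow]
    have hw' : ‖w ^ n‖ = 1 := by rw [norm_pow, hw, one_pow]
    rw [inv_pow, inv_eq_conj hw']
    generalize z ^ n = u at *
    generalize w ^ n = v at *
    have hu2 : u.re ^ 2 + u.im ^ 2 = 1 := by
      have := Complex.sq_norm u; rw [hz', normSq_apply] at this; nlinarith
    have hv2 : v.re ^ 2 + v.im ^ 2 = 1 := by
      have := Complex.sq_norm v; rw [hw', normSq_apply] at this; nlinarith
    have : (u * (starRingEnd ℂ) v).re = u.re * v.re + u.im * v.im := by simp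
    rw [this]
    have h : 0 ≤ a ^ n * ((1 + u.re + v.re) ^ 2 + (u.im + v.im) ^ 2) := by positivity
    have e : (1 + u.re + v.re) ^ 2 + (u.im + v.im) ^ 2 = 3 + 2 * u.re + 2 * v.re +
      2 * (u.re * v.re + u.im * v.im) := by nlinarith
    rw [e] at h
    nlinarith

lemma norm_product3_ge_one {N : ℕ} [NeZero N] (χ ψ : DirichletCharacter ℂ N) {x : ℝ} (hx : 0 < x) :
    1 ≤ ‖LFunctionTrivChar N (1 + x) ^ 3 * LFunction χ (1 + x) ^ 2 * LFunction ψ (1 + x) ^ 2 *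
      LFunction (χ * ψ⁻¹) (1 + x) ^ 2‖ := by
  have h₀ : 1 < (1 + x : ℂ).re := by simp [hx]
  rw [LFunctionTrivChar]
  simp only [LFunction_eq_LSeries _ h₀]
  have H₀ := summable_neg_log_one_sub_mul_prime_cpow (N := N) 1 h₀
  have H₁ := summable_neg_log_one_sub_mul_prime_cpow χ h₀
  have H₂ := summable_neg_log_one_sub_mul_prime_cpow ψ h₀
  have H₃ := summable_neg_log_one_sub_mul_prime_cpow (χ * ψ⁻¹) h₀
  have hsum₀ := (hasSum_re H₀.hasSum).mul_left 3
  have hsum₁ := (hasSum_re H₁.hasSum).mul_left 2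
  have hsum₂ := (hasSum_re H₂.hasSum).mul_left 2
  have hsum₃ := (hasSum_re H₃.hasSum).mul_left 2
  rw [← LSeries_eulerProduct_exp_log _ h₀, ← LSeries_eulerProduct_exp_log χ h₀,
    ← LSeries_eulerProduct_exp_log ψ h₀, ← LSeries_eulerProduct_exp_log _ h₀]
  simp only [← exp_nat_mul, Nat.cast_ofNat, ← exp_add, norm_exp, add_re, mul_re,
    re_ofNat, im_ofNat, zero_mul, sub_zero, Real.one_le_exp_iff]
  have := ((hsum₀.add hsum₁).add hsum₂).add hsum₃
  rw [← this.tsum_eq]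
  refine tsum_nonneg fun p => ?_
  by_cases hn' : IsUnit ((p : ℕ) : ZMod N)
  · have hn : ((p : ℕ) : ℝ) ^ (-(1 + x)) < 1 := by
      rw [Real.rpow_neg (Nat.cast_nonneg _), inv_lt_one_iff₀]
      exact .inr <| Real.one_lt_rpow (mod_cast p.prop.one_lt) (by linarith)
    have hz : ‖χ (p : ℕ)‖ = 1 := by
      rw [← hn'.unit_spec, DirichletCharacter.unit_norm_eq_one χ hn'.unit]
    have hw : ‖ψ (p : ℕ)‖ = 1 := by
      rw [← hn'.unit_spec, DirichletCharacter.unit_norm_eq_one ψ hn'.unit]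
    have hm := re_log_comb3 (by positivity) hn hz hw
    have e : ((((p : ℕ) : ℝ) ^ (-(1 + x)) : ℝ) : ℂ) = ((p : ℕ) : ℂ) ^ (-(1 + (x : ℂ))) := by
      rw [ofReal_cpow (Nat.cast_nonneg _)]; push_cast; rfl
    rw [e] at hm
    have e2 : (χ * ψ⁻¹) ((p : ℕ) : ZMod N) = χ (p : ℕ) * (ψ (p : ℕ))⁻¹ := by
      rw [MulChar.mul_apply, MulChar.inv_apply_eq_inv, Ring.inverse_eq_inv]
    rw [MulChar.one_apply hn', one_mul, e2]
    simpa only [mul_comm] using hm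
  · simp [MulChar.map_nonunit _ hn']


lemma repulsion : ∃ C : ℝ, 1 ≤ C ∧ 
    (∀ (N : ℕ) [NeZero N], ∑ p ∈ N.primeFactors, 1 / ((p : ℝ) - 1) ≤ 1/4 →
      ∀ ℓ : ℝ, 1 ≤ ℓ → Real.log N ≤ ℓ → ∀ s : ℂ, ‖s - 1‖ ≤ 1 / (4 * ℓ) →
      ‖LFunctionTrivChar₁ N s‖ ≤ C * ℓ) ∧
    (∀ (N : ℕ) [NeZero N] (χ : DirichletCharacter ℂ N),
      χ ≠ 1 → ∀ ℓ : ℝ, 1 ≤ ℓ → Real.log N ≤ ℓ → ∀ s : ℂ, ‖s - 1‖ ≤ 1 / (4 * ℓ) →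
      ‖χ.LFunction s‖ ≤ C * ℓ) ∧
    (∀ (N : ℕ) [NeZero N], ∑ p ∈ N.primeFactors, 1 / ((p : ℝ) - 1) ≤ 1/4 →
      ∀ ℓ : ℝ, 1 ≤ ℓ → Real.log N ≤ ℓ → ∀ χ ψ : DirichletCharacter ℂ N, χ ≠ 1 → ψ ≠ 1 → χ ≠ ψ →
      ‖χ.LFunction 1‖ < 1 / (C * ℓ ^ 10) → 1 / (C * ℓ ^ 10) ≤ ‖ψ.LFunction 1‖) := by
  obtain ⟨C₁, hC₁, H₁⟩ := TrivChar₁_bound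
  obtain ⟨C₂, hC₂, H₂⟩ := LFunction_near_one_bound
  set D := max C₁ C₂ with hD
  have hD1 : 1 ≤ D := hC₁.trans (le_max_left _ _)
  have hDC : D ≤ 7000 * D ^ 9 := by nlinarith [pow_le_pow_right₀ hD1 (show 1 ≤ 9 by norm_num)]
  refine ⟨7000 * D ^ 9, hD1.trans hDC, ?_, ?_, ?_⟩
  · intro N _ hN ℓ hℓ hl s hs
    calc _ ≤ C₁ := H₁ N hN ℓ hℓ hl s hs
      _ ≤ D * 1 := by rw [mul_one]; exact le_max_left _ _
      _ ≤ _ := by gcongr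
  · intro N _ χ hχ ℓ hℓ hl s hs
    calc _ ≤ C₂ * ℓ := H₂ N χ hχ ℓ hℓ hl s hs
      _ ≤ D * ℓ := by gcongr; exact le_max_right _ _
      _ ≤ _ := by gcongr
  · intro N _ hN ℓ hℓ hl χ ψ hχ hψ hne h1
    by_contra! h2
    set ε : ℝ := 1 / (7000 * D ^ 9 * ℓ ^ 10) with hε
    have hε0 : 0 < ε := by positivity
    have hε1 : ε ≤ 1 / (8 * ℓ) := by
      apply one_div_le_one_div_of_le (by positivity)
      have e1 : 1 ≤ D ^ 9 := one_le_pow₀ hD1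
      have e2 : ℓ ≤ ℓ ^ 10 := le_self_pow₀ hℓ (by norm_num)
      nlinarith
    have h8 : 1 / (8 * ℓ) = 1 / (4 * ℓ) / 2 := by field_simp; norm_num
    have hn : ‖((1 + ε : ℂ)) - 1‖ = ε := by
      rw [add_sub_cancel_left, norm_real, Real.norm_of_nonneg hε0.le]
    have hn4 : ‖((1 + ε : ℂ)) - 1‖ ≤ 1 / (4 * ℓ) := by
      rw [hn]; refine hε1.trans ?_
      apply one_div_le_one_div_of_le <;> linarith
    have hx : ∀ θ : DirichletCharacter ℂ N, θ ≠ 1 → ‖θ.LFunction 1‖ < ε →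
        ‖θ.LFunction (1 + ε)‖ ≤ 9 * D * ℓ ^ 2 * ε := by
      intro θ hθ hl1
      have := (dist_one_bound (θ.differentiable_LFunction hθ) (ρ := 1 / (4 * ℓ)) (B := D * ℓ) (by positivity)
        (fun s hs => (H₂ N θ hθ ℓ hℓ hl s hs).trans (by gcongr; exact le_max_right _ _)) (1 + ε)
        (by rw [hn]; linarith)).2
      rw [hn] at this
      have h3 := norm_add_le (θ.LFunction (1 + ε) - θ.LFunction 1) (θ.LFunction 1)
      rw [sub_add_cancel] at h3
      have h4 : 2 * (D * ℓ) / (1 / (4 * ℓ)) * ε = 8 * D * ℓ ^ 2 * ε := by field_simp; norm_num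
      have h5 : 1 ≤ D * ℓ ^ 2 := one_le_mul_of_one_le_of_one_le hD1 (one_le_pow₀ hℓ)
      nlinarith
    have h3 := norm_product3_ge_one χ ψ hε0
    have ha : ‖LFunctionTrivChar N (1 + ε)‖ ≤ D / ε := by
      have := H₁ N hN ℓ hℓ hl (1 + ε) hn4
      rw [LFunctionTrivChar₁, Function.update_of_ne (by simpa using hε0.ne'), norm_mul, hn] at this
      rw [le_div_iff₀ hε0, mul_comm]
      exact this.trans (le_max_left _ _)
    have hb := hx χ hχ h1
    have hc := hx ψ hψ h2
    have hd : ‖LFunction (χ * ψ⁻¹) (1 + ε)‖ ≤ D * ℓ := by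
      refine (H₂ N (χ * ψ⁻¹) ?_ ℓ hℓ hl _ hn4).trans (by gcongr; exact le_max_right _ _)
      rwa [Ne, mul_inv_eq_one]
    have h4 : ‖LFunctionTrivChar N (1 + ε) ^ 3 * LFunction χ (1 + ε) ^ 2 * LFunction ψ (1 + ε) ^ 2 *
      LFunction (χ * ψ⁻¹) (1 + ε) ^ 2‖ ≤ (D / ε) ^ 3 * (9 * D * ℓ ^ 2 * ε) ^ 2 * (9 * D * ℓ ^ 2 * ε) ^ 2 * (D * ℓ) ^ 2 := by
      simp only [norm_mul, norm_pow]
      gcongr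
    have h5 : (D / ε) ^ 3 * (9 * D * ℓ ^ 2 * ε) ^ 2 * (9 * D * ℓ ^ 2 * ε) ^ 2 * (D * ℓ) ^ 2 = 
        6561 / 7000 := by
      have : (D / ε) ^ 3 * (9 * D * ℓ ^ 2 * ε) ^ 2 * (9 * D * ℓ ^ 2 * ε) ^ 2 * (D * ℓ) ^ 2 =
        6561 * (D ^ 9 * ℓ ^ 10 * ε) := by field_simp; ring
      rw [this, hε]; field_simp
    rw [h5] at h4
    have h6 := h3.trans h4
    norm_num at h6

end

section
open Complex DirichletCharacter

lemma primeFactors_prod_sq {Q : Finset ℕ} (hQ : ∀ p ∈ Q, p.Prime) {d : ℕ} (hd : d ∣ (∏ p ∈ Q, p) ^ 2) :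
    d.primeFactors ⊆ Q := by
  intro p hp
  have hpp := Nat.prime_of_mem_primeFactors hp
  have h1 := hpp.dvd_of_dvd_pow ((Nat.dvd_of_mem_primeFactors hp).trans hd)
  obtain ⟨q, hq, hpq⟩ := (hpp.prime.dvd_finset_prod_iff _).mp h1
  rwa [(Nat.prime_dvd_prime_iff_eq hpp (hQ q hq)).mp hpq]

lemma sum_primeFactors_le {Q : Finset ℕ} (hQ : ∀ p ∈ Q, p.Prime)
    (hs : ∑ p ∈ Q, 1 / ((p : ℝ) - 1) ≤ 1/4) {d : ℕ} (hd : d ∣ (∏ p ∈ Q, p) ^ 2) :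
    ∑ p ∈ d.primeFactors, 1 / ((p : ℝ) - 1) ≤ 1/4 := by
  refine le_trans (Finset.sum_le_sum_of_subset_of_nonneg (primeFactors_prod_sq hQ hd) ?_) hs
  intro p hp _
  have hp2 : (2:ℝ) ≤ p := by exact_mod_cast (hQ p hp).two_le
  have : 0 ≤ (p:ℝ) - 1 := by linarith
  positivity

lemma good_subset : ∃ C : ℝ, 1 ≤ C ∧ ∀ Q : Finset ℕ, (∀ p ∈ Q, p.Prime) →
    ∑ p ∈ Q, 1 / ((p : ℝ) - 1) ≤ 1/4 → ∀ ℓ : ℝ, 1 ≤ ℓ → 2 * Real.log (∏ p ∈ Q, p : ℕ) ≤ ℓ →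
    ∃ Q' ⊆ Q, Q.card ≤ Q'.card + 1 ∧ ∀ (d : ℕ) [NeZero d], d ∣ (∏ p ∈ Q', p) ^ 2 →
      ∀ s : ℂ, ‖s - 1‖ ≤ 3 * (1 / (C * ℓ ^ 12)) → 
      (LFunctionTrivChar₁ d s ≠ 0 ∧ 
        ‖deriv (LFunctionTrivChar₁ d) s / LFunctionTrivChar₁ d s‖ ≤ C * ℓ ^ 12) ∧
      ∀ χ : DirichletCharacter ℂ d, χ ≠ 1 → χ.LFunction s ≠ 0 ∧ 
        ‖deriv χ.LFunction s / χ.LFunction s‖ ≤ C * ℓ ^ 12 := by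
  obtain ⟨C, hC, HT, HL, HR⟩ := repulsion
  refine ⟨96 * C ^ 2, by nlinarith, ?_⟩
  intro Q hQ hsum ℓ hℓ hlog
  set R := (∏ p ∈ Q, p) ^ 2 with hR
  have hP0 : (∏ p ∈ Q, p) ≠ 0 := Finset.prod_ne_zero_iff.mpr fun p hp => (hQ p hp).ne_zero
  have hR0 : NeZero R := ⟨pow_ne_zero _ hP0⟩
  have hlogR : Real.log R ≤ ℓ := by
    rw [hR, Nat.cast_pow, Real.log_pow]; exact_mod_cast hlog
  have hlogd : ∀ d, d ∣ R → Real.log d ≤ ℓ := by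
    intro d hd
    rcases Nat.eq_zero_or_pos d with rfl | hd0
    · simp; linarith
    refine (Real.log_le_log (by exact_mod_cast hd0) ?_).trans hlogR
    exact_mod_cast Nat.le_of_dvd (Nat.pos_of_ne_zero hR0.ne) hd
  set δ := 1 / (C * ℓ ^ 10) with hδ
  have hδ0 : 0 < δ := by positivity
  have main : ∃ Q' ⊆ Q, Q.card ≤ Q'.card + 1 ∧ ∀ (d : ℕ) [NeZero d], d ∣ (∏ p ∈ Q', p) ^ 2 →
      ∀ χ : DirichletCharacter ℂ d, χ ≠ 1 → ∀ hdR : d ∣ R, δ ≤ ‖(changeLevel hdR χ).LFunction 1‖ := by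
    by_cases hbad : ∃ χ : DirichletCharacter ℂ R, χ ≠ 1 ∧ ‖χ.LFunction 1‖ < δ
    · obtain ⟨ψ, hψ, hψδ⟩ := hbad
      have hcond : ψ.conductor ≠ 1 := fun h => hψ ((eq_one_iff_conductor_eq_one).mpr h)
      obtain ⟨q, hq, hqc⟩ := Nat.exists_prime_and_dvd hcond
      have hqQ : q ∈ Q := primeFactors_prod_sq hQ (dvd_refl _) (Nat.mem_primeFactors.mpr
        ⟨hq, hqc.trans ψ.conductor_dvd_level, hR0.ne⟩)
      refine ⟨Q.erase q, Finset.erase_subset _ _, by rw [Finset.card_erase_add_one hqQ], ?_⟩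
      intro d _ hd χ hχ hdR
      refine HR R (sum_primeFactors_le hQ hsum (dvd_refl _)) ℓ hℓ hlogR ψ _ hψ ?_ ?_ hψδ
      · exact fun h => hχ ((changeLevel_eq_one_iff hdR).mp h)
      · rintro rfl
        rw [conductor_changeLevel] at hqc
        have hqd : q ∣ d := hqc.trans χ.conductor_dvd_level
        have : q ∈ Q.erase q := primeFactors_prod_sq (Q := Q.erase q)
          (fun p hp => hQ p (Finset.mem_of_mem_erase hp)) hd
          (Nat.mem_primeFactors.mpr ⟨hq, hqd, NeZero.ne d⟩)
        simp at this
    · push Not at hbad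
      refine ⟨Q, subset_rfl, by omega, ?_⟩
      intro d _ hd χ hχ hdR
      exact hbad _ fun h => hχ ((changeLevel_eq_one_iff hdR).mp h)
  obtain ⟨Q', hQ', hcard, hmain⟩ := main
  refine ⟨Q', hQ', hcard, ?_⟩
  intro d _ hd s hs
  have hdR : d ∣ R := hd.trans (pow_dvd_pow_of_dvd (Finset.prod_dvd_prod_of_subset _ _ _ hQ') 2)
  have hη : 3 * (1 / (96 * C ^ 2 * ℓ ^ 12)) = 1 / (32 * C ^ 2 * ℓ ^ 12) := by field_simp; norm_num
  rw [hη] at hs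
  have hη1 : 1 / (32 * C ^ 2 * ℓ ^ 12) ≤ 1 / (4 * ℓ) / 2 := by
    rw [div_div]
    apply one_div_le_one_div_of_le (by positivity)
    have e1 : 1 ≤ C ^ 2 := one_le_pow₀ hC
    have e2 : ℓ ≤ ℓ ^ 12 := le_self_pow₀ hℓ (by norm_num)
    nlinarith
  have hη2 : 1 / (32 * C ^ 2 * ℓ ^ 12) * (2 * (C * ℓ) / (1 / (4 * ℓ))) ≤ δ / 2 / 2 := by
    rw [hδ]; apply le_of_eq; field_simp; norm_num
  have hfin : 1 / (1 / (32 * C ^ 2 * ℓ ^ 12)) ≤ 96 * C ^ 2 * ℓ ^ 12 := by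
    rw [one_div_one_div]; gcongr; norm_num
  have hδ34 : δ / 2 ≤ 3 / 4 := by
    have : δ ≤ 1 := by
      rw [hδ, div_le_one (by positivity)]
      exact one_le_mul_of_one_le_of_one_le hC (one_le_pow₀ hℓ)
    linarith
  have hsd := sum_primeFactors_le hQ hsum hdR
  constructor
  · obtain ⟨h1, h2⟩ := logDeriv_one_bound (differentiable_LFunctionTrivChar₁ d) (by positivity)
      (HT d hsd ℓ hℓ (hlogd d hdR)) (half_pos hδ0)
      (hδ34.trans (TrivChar₁_one d hsd)) (by positivity) hη1 hη2 s hs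
    exact ⟨h1, h2.trans hfin⟩
  · intro χ hχ
    have hL1 : δ / 2 ≤ ‖χ.LFunction 1‖ := by
      have h1 := hmain d hd χ hχ hdR
      rw [LFunction_changeLevel hdR χ (Or.inl hχ), norm_mul] at h1
      have h2 : ‖∏ p ∈ R.primeFactors, (1 - χ p * (p : ℂ) ^ (-1 : ℂ))‖ ≤ 2 := by
        rw [norm_prod]
        calc _ ≤ ∏ p ∈ R.primeFactors, Real.exp (1 / ((p : ℝ) - 1)) := by
              refine Finset.prod_le_prod (fun _ _ => norm_nonneg _) fun p hp => ?_
              have hp2 : (2:ℝ) ≤ p := by exact_mod_cast (Nat.prime_of_mem_primeFactors hp).two_le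
              refine le_trans ?_ (Real.add_one_le_exp _)
              refine (norm_sub_le _ _).trans ?_
              rw [norm_one, add_comm, norm_mul, cpow_neg_one, norm_inv, norm_natCast]
              gcongr
              calc _ ≤ 1 * (p:ℝ)⁻¹ := by gcongr; exact χ.norm_le_one _
                _ = 1 / (p:ℝ) := by simp
                _ ≤ _ := by apply one_div_le_one_div_of_le <;> linarith
          _ = Real.exp (∑ p ∈ R.primeFactors, 1 / ((p : ℝ) - 1)) := by rw [Real.exp_sum]
          _ ≤ Real.exp (1/2) := by
              rw [Real.exp_le_exp]; linarith [sum_primeFactors_le hQ hsum (dvd_refl R)]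
          _ ≤ 2 := by
            have h4 : Real.exp (1/2) ^ 2 = Real.exp 1 := by
              rw [← Real.exp_nat_mul]; norm_num
            have h3 := Real.exp_one_lt_d9
            nlinarith [Real.exp_pos (1/2)]
      nlinarith [norm_nonneg (χ.LFunction 1)]
    obtain ⟨h1, h2⟩ := logDeriv_one_bound (χ.differentiable_LFunction hχ) (by positivity)
      (HL d χ hχ ℓ hℓ (hlogd d hdR)) (half_pos hδ0) hL1 (by positivity) hη1 hη2 s hs
    exact ⟨h1, h2.trans hfin⟩

end

section
open Complex DirichletCharacter ArithmeticFunction.vonMangoldt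

/-- weighted term -/
noncomputable def tm (k : ℕ) (η : ℝ) (n : ℕ) : ℝ :=
  ArithmeticFunction.vonMangoldt n * Real.log n ^ k / (n : ℝ) ^ (1 + η)

lemma tm_nonneg (k : ℕ) (η : ℝ) (n : ℕ) : 0 ≤ tm k η n := by
  unfold tm
  have := ArithmeticFunction.vonMangoldt_nonneg (n := n)
  have := Real.log_natCast_nonneg n
  positivity

def HasGood (η : ℝ) (d : ℕ) [NeZero d] : Prop := ∀ s : ℂ, ‖s - 1‖ ≤ 3 * η → 
      (LFunctionTrivChar₁ d s ≠ 0 ∧ 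
        ‖deriv (LFunctionTrivChar₁ d) s / LFunctionTrivChar₁ d s‖ ≤ 1 / η) ∧
      ∀ χ : DirichletCharacter ℂ d, χ ≠ 1 → χ.LFunction s ≠ 0 ∧ 
        ‖deriv χ.LFunction s / χ.LFunction s‖ ≤ 1 / η

lemma aux_bound {η : ℝ} (hη : 0 < η) (d : ℕ) [NeZero d] (h : HasGood η d) (s : ℂ) (hs : ‖s - 1‖ ≤ 3 * η) :
    ‖LFunctionResidueClassAux (1 : ZMod d) s‖ ≤ 1 / η := by
  classical
  obtain ⟨⟨h0, h1⟩, h2⟩ := h s hs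
  have hφ : (0:ℝ) < d.totient := by exact_mod_cast Nat.totient_pos.mpr (Nat.pos_of_ne_zero (NeZero.ne d))
  unfold LFunctionResidueClassAux
  rw [norm_mul, norm_inv, norm_natCast, inv_mul_le_iff₀ hφ]
  refine (norm_sub_le _ _).trans ?_
  rw [neg_div, norm_neg]
  have h3 : ‖∑ χ ∈ ({1}ᶜ : Finset (DirichletCharacter ℂ d)), χ (1 : ZMod d)⁻¹ * deriv χ.LFunction s / χ.LFunction s‖
      ≤ ∑ χ ∈ ({1}ᶜ : Finset (DirichletCharacter ℂ d)), 1 / η := by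
    refine norm_sum_le_of_le _ fun χ hχ => ?_
    rw [mul_div_assoc, norm_mul]
    have := (h2 χ (by simpa using hχ)).2
    calc _ ≤ 1 * (1 / η) := by
          gcongr
          exact χ.norm_le_one _
      _ = _ := one_mul _
  have h5 : 1 / η + ∑ χ ∈ ({1}ᶜ : Finset (DirichletCharacter ℂ d)), 1 / η = d.totient * (1 / η) := by
        rw [Finset.sum_const, Finset.card_compl, Finset.card_singleton, ← Nat.card_eq_fintype_card,
          card_eq_totient_of_hasEnoughRootsOfUnity, nsmul_eq_mul, Nat.cast_sub, Nat.cast_one]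
        · ring
        · exact Nat.totient_pos.mpr (Nat.pos_of_ne_zero (NeZero.ne d))
  rw [← h5]
  refine le_trans (le_of_eq ?_) (add_le_add h1 h3)
  congr!

lemma aux_diff {η : ℝ} (hη : 0 < η) (d : ℕ) [NeZero d] (h : HasGood η d) :
    DifferentiableOn ℂ (LFunctionResidueClassAux (1 : ZMod d)) (Metric.closedBall 1 (3 * η)) := by
  intro s hs
  rw [mem_closedBall_iff_norm] at hs
  obtain ⟨⟨h0, h1⟩, h2⟩ := h s hs
  apply DifferentiableAt.differentiableWithinAt
  unfold LFunctionResidueClassAux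
  have hd : ∀ f : ℂ → ℂ, Differentiable ℂ f → Differentiable ℂ (deriv f) := fun f hf => hf.deriv
  refine DifferentiableAt.const_mul (DifferentiableAt.sub ?_ ?_) _
  · exact ((hd _ (differentiable_LFunctionTrivChar₁ d)) s).neg.div
      ((differentiable_LFunctionTrivChar₁ d) s) h0
  · refine DifferentiableAt.fun_sum fun χ hχ => ?_
    have hχ1 : χ ≠ 1 := by simpa using hχ
    exact (((hd _ (χ.differentiable_LFunction hχ1)) s).const_mul _).div
      ((χ.differentiable_LFunction hχ1) s) (h2 χ hχ1).1

lemma logMul_iter (k : ℕ) (f : ℕ → ℂ) (n : ℕ) : LSeries.logMul^[k] f n = log n ^ k * f n := by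
  induction k with
  | zero => simp
  | succ k ih => rw [Function.iterate_succ_apply', LSeries.logMul, ih]; ring

lemma S_hasSum {η : ℝ} (hη : 0 < η) (d : ℕ) (k : ℕ) :
    Summable (fun n : ℕ => if (n : ZMod d) = 1 then tm k η n else 0) ∧
    ((∑' n : ℕ, if (n : ZMod d) = 1 then tm k η n else 0 : ℝ) : ℂ) =
      LSeries (LSeries.logMul^[k] (fun n => ((residueClass (1 : ZMod d) n : ℝ) : ℂ))) (1 + η) := by
  have habs : LSeries.abscissaOfAbsConv (LSeries.logMul^[k] (fun n => ((residueClass (1 : ZMod d) n : ℝ) : ℂ)))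
      < ((1 + η : ℂ).re : EReal) := by
    rw [LSeries.absicssaOfAbsConv_logPowMul]
    refine (abscissaOfAbsConv_residueClass_le_one (1 : ZMod d)).trans_lt ?_
    simp only [add_re, one_re, ofReal_re]
    exact_mod_cast (by linarith : (1:ℝ) < 1 + η)
  have hs := LSeriesSummable_of_abscissaOfAbsConv_lt_re habs
  have hterm : LSeries.term (LSeries.logMul^[k] (fun n => ((residueClass (1 : ZMod d) n : ℝ) : ℂ))) (1 + η) =
      fun n : ℕ => ((if (n : ZMod d) = 1 then tm k η n else 0 : ℝ) : ℂ) := by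
    ext n
    rcases eq_or_ne n 0 with rfl | hn
    · simp [tm]
    · rw [LSeries.term_of_ne_zero hn, logMul_iter]
      by_cases h : (n : ZMod d) = 1
      · simp only [h, if_true, tm, residueClass]
        rw [Set.indicator_of_mem (by simpa using h)]
        push_cast
        rw [ofReal_cpow (Nat.cast_nonneg n), ← natCast_log]
        push_cast
        ring
      · simp only [h, if_false, residueClass]
        rw [Set.indicator_of_notMem (by simpa using h)]
        simp
  unfold LSeriesSummable at hs
  rw [hterm] at hs
  refine ⟨by exact_mod_cast hs, ?_⟩
  rw [LSeries, hterm, ofReal_tsum]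

lemma S_asymp {η : ℝ} (hη : 0 < η) (d : ℕ) [NeZero d] (h : HasGood η d) (k : ℕ) :
    |(∑' n : ℕ, if (n : ZMod d) = 1 then tm k η n else 0) - k.factorial / (d.totient * η ^ (k+1))| ≤
      k.factorial / (η ^ (k+1) * 2 ^ k) := by
  obtain ⟨h1, h2⟩ := S_hasSum hη d k
  set S := (∑' n : ℕ, if (n : ZMod d) = 1 then tm k η n else 0) with hS
  have hC := norm_iteratedDeriv_le_of_forall_mem_sphere_norm_le (c := 1 + η) (R := 2 * η) (C := 1 / η)
    (f := LFunctionResidueClassAux (1 : ZMod d)) k (by linarith)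
    ((aux_diff hη d h).diffContOnCl_ball (by
      apply Metric.closedBall_subset_closedBall'
      rw [dist_eq_norm, add_sub_cancel_left, norm_real, Real.norm_of_nonneg hη.le]; linarith))
    (fun z hz => aux_bound hη d h z (by
      rw [mem_sphere_iff_norm] at hz
      have := norm_add_le (z - (1 + η)) η
      rw [hz, norm_real, Real.norm_of_nonneg hη.le] at this
      have e : z - (1 + η) + η = z - 1 := by ring
      rw [e] at this
      linarith))
  have hev : LFunctionResidueClassAux (1 : ZMod d) =ᶠ[nhds (1 + η : ℂ)]
      (fun s ↦ LSeries (fun n => ((residueClass (1 : ZMod d) n : ℝ) : ℂ)) s - (d.totient : ℂ)⁻¹ * (1 * s - 1)⁻¹) := by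
    have : {s : ℂ | 1 < s.re} ∈ nhds (1 + η : ℂ) :=
      (isOpen_lt continuous_const continuous_re).mem_nhds (by simp [hη])
    filter_upwards [this] with s hs
    rw [eqOn_LFunctionResidueClassAux isUnit_one hs]
    simp only [div_eq_mul_inv, one_mul]
  have habs : LSeries.abscissaOfAbsConv (fun n => ((residueClass (1 : ZMod d) n : ℝ) : ℂ))
      < ((1 + η : ℂ).re : EReal) := by
    refine (abscissaOfAbsConv_residueClass_le_one (1 : ZMod d)).trans_lt ?_
    simp only [add_re, one_re, ofReal_re]
    exact_mod_cast (by linarith : (1:ℝ) < 1 + η)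
  have hη0 : (η : ℂ) ≠ 0 := by exact_mod_cast hη.ne'
  have hne : (1 * (1 + η) - 1 : ℂ) ≠ 0 := by simpa using hη0
  rw [hev.iteratedDeriv_eq k] at hC
  have hcd1 : ContDiffAt ℂ k (LSeries (fun n => ((residueClass (1 : ZMod d) n : ℝ) : ℂ))) (1 + η) :=
    (LSeries_analyticOnNhd _ _ habs).contDiffAt
  have hcd2 : ContDiffAt ℂ k (fun s : ℂ => (d.totient : ℂ)⁻¹ * (1 * s - 1)⁻¹) (1 + η) := by
    refine contDiffAt_const.mul (ContDiffAt.inv ?_ hne)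
    fun_prop
  have hsub := iteratedDeriv_sub hcd1 hcd2
  rw [Pi.sub_def] at hsub
  rw [hsub, LSeries_iteratedDeriv k habs, ← h2, iteratedDeriv_const_mul_field, iteratedDeriv_eq_iterate,
    iter_deriv_inv_linear_sub] at hC
  have e : (-1 : ℂ) ^ k * (S : ℂ) - (d.totient : ℂ)⁻¹ * ((-1) ^ k * k.factorial * 1 ^ k * (1 * (1 + η) - 1) ^ (-1 - k : ℤ))
      = (-1) ^ k * ((S - k.factorial / (d.totient * η ^ (k+1)) : ℝ) : ℂ) := by
    have e2 : (1 * (1 + η) - 1 : ℂ) ^ (-1 - k : ℤ) = ((η : ℂ) ^ (k + 1))⁻¹ := by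
      rw [one_mul, add_sub_cancel_left, ← zpow_natCast, ← zpow_neg]
      congr 1; push_cast; ring
    rw [e2, one_pow, mul_one]; push_cast; field_simp
  rw [e, norm_mul, norm_pow, norm_neg, norm_one, one_pow, one_mul, norm_real, Real.norm_eq_abs] at hC
  refine hC.trans (le_of_eq ?_)
  field_simp
  ring

end

section
open ArithmeticFunction

lemma log_pow_le (k : ℕ) {a u : ℝ} (ha : 0 < a) (hu : 1 ≤ u) :
    Real.log u ^ k ≤ k.factorial / a ^ k * u ^ a := by
  have h0 : 0 ≤ Real.log u := Real.log_nonneg hu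
  have h1 := Real.pow_div_factorial_le_exp (a * Real.log u) (by positivity) k
  rw [show a * Real.log u = Real.log u * a by ring, ← Real.rpow_def_of_pos (by linarith)] at h1
  rw [div_le_iff₀ (by positivity), mul_pow] at h1
  rw [div_mul_eq_mul_div, le_div_iff₀ (by positivity)]
  linarith

lemma np_section (n : ℕ) (hn : ¬ n.Prime) (h : vonMangoldt n ≠ 0) :
    ∃ q : ℕ × ℕ, q.1 ^ 2 * q.2 ^ 3 = n := by
  rw [vonMangoldt_ne_zero_iff] at h
  obtain ⟨p, a, hp, ha, rfl⟩ := h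
  have hp' := hp.nat_prime
  have ha1 : a ≠ 1 := by rintro rfl; simp [hp'] at hn
  rcases Nat.even_or_odd' a with ⟨b, rfl | rfl⟩
  · exact ⟨(p ^ b, 1), by simp [← pow_mul, mul_comm]⟩
  · obtain ⟨b, rfl⟩ : ∃ c, b = c + 1 := ⟨b - 1, by omega⟩
    refine ⟨(p ^ b, p), ?_⟩
    simp only [← pow_mul, ← pow_add]
    congr 1; ring

lemma tm_le (k : ℕ) {η : ℝ} (hη : 0 < η) (n : ℕ) (hn : 0 < n) :
    tm k η n ≤ 8 * (k.factorial * 8 ^ k) * (n : ℝ) ^ (-(3:ℝ)/4) := by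
  have hn1 : (1:ℝ) ≤ n := by exact_mod_cast hn
  have hn0 : (0:ℝ) < n := by linarith
  have h1 := log_pow_le k (a := 1/8) (by norm_num) hn1
  have h2 := log_pow_le 1 (a := 1/8) (by norm_num) hn1
  have h3 : vonMangoldt n ≤ Real.log n := vonMangoldt_le_log
  simp at h2
  have e1 : (k.factorial : ℝ) / (1/8) ^ k = k.factorial * 8 ^ k := by
    rw [one_div, inv_pow, div_inv_eq_mul]
  rw [e1] at h1
  unfold tm
  have hl := Real.log_nonneg hn1
  have h4 : ((n:ℝ) ^ (1 + η))⁻¹ ≤ (n:ℝ) ^ (-(1:ℝ)) := by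
    rw [← Real.rpow_neg hn0.le]
    exact Real.rpow_le_rpow_of_exponent_le hn1 (by linarith)
  rw [div_eq_mul_inv]
  calc _ ≤ (8 * (n:ℝ) ^ (1/8:ℝ)) * (k.factorial * 8 ^ k * (n:ℝ) ^ (1/8:ℝ)) * (n:ℝ) ^ (-(1:ℝ)) := by
        gcongr
        refine h3.trans (h2.trans (le_of_eq (by norm_num)))
    _ = 8 * (k.factorial * 8 ^ k) * ((n:ℝ) ^ (1/8:ℝ) * (n:ℝ) ^ (1/8:ℝ) * (n:ℝ) ^ (-(1:ℝ))) := by ring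
    _ = _ := by
        rw [← Real.rpow_add hn0, ← Real.rpow_add hn0]; norm_num

lemma np_bound : ∃ C : ℝ, 0 ≤ C ∧ ∀ (k : ℕ) (η : ℝ), 0 < η →
    Summable (fun n => if n.Prime then 0 else tm k η n) ∧ 
    ∑' n, (if n.Prime then 0 else tm k η n) ≤ C * (k.factorial * 8 ^ k) := by
  classical
  have s1 : Summable (fun x : ℕ => (x:ℝ) ^ (-(3:ℝ)/2)) := by
    rw [Real.summable_nat_rpow]; norm_num
  have s2 : Summable (fun x : ℕ => (x:ℝ) ^ (-(9:ℝ)/4)) := by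
    rw [Real.summable_nat_rpow]; norm_num
  set g : ℕ × ℕ → ℝ := fun q => (q.1:ℝ) ^ (-(3:ℝ)/2) * (q.2:ℝ) ^ (-(9:ℝ)/4) with hg
  have hgs : Summable g := s1.mul_of_nonneg s2 (fun _ => by positivity) (fun _ => by positivity)
  have hg0 : ∀ q, 0 ≤ g q := fun q => by simp only [hg]; positivity
  refine ⟨8 * ∑' q, g q, mul_nonneg (by norm_num) (tsum_nonneg hg0), fun k η hη => ?_⟩
  set f : ℕ → ℝ := fun n => if n.Prime then 0 else tm k η n with hf
  have hf0 : ∀ n, 0 ≤ f n := by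
    intro n; simp only [hf]; split_ifs; exacts [le_rfl, tm_nonneg _ _ _]
  have hsec : ∀ n, f n ≠ 0 → ∃ q : ℕ × ℕ, q.1 ^ 2 * q.2 ^ 3 = n := by
    intro n hn
    have hp : ¬ n.Prime := by rintro h; simp [hf, h] at hn
    refine np_section n hp ?_
    intro h0
    simp [hf, hp, tm, h0] at hn
  choose! σ hσ using hsec
  have key : ∀ s : Finset ℕ, ∑ n ∈ s, f n ≤ 8 * (∑' q, g q) * (k.factorial * 8 ^ k) := by
    intro s
    rw [← Finset.sum_filter_ne_zero]
    calc _ ≤ ∑ n ∈ s with f n ≠ 0, 8 * (k.factorial * 8 ^ k) * g (σ n) := by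
          refine Finset.sum_le_sum fun n hn => ?_
          have hn0 : f n ≠ 0 := (Finset.mem_filter.mp hn).2
          have hp : ¬ n.Prime := by rintro h; simp [hf, h] at hn0
          have hpos : 0 < n := by
            rcases Nat.eq_zero_or_pos n with rfl | h
            · simp [hf, tm] at hn0
            · exact h
          have := tm_le k hη n hpos
          have e : f n = tm k η n := by simp [hf, hp]
          rw [e]
          refine this.trans (le_of_eq ?_)
          congr 1
          conv_lhs => rw [← hσ n hn0]
          simp only [hg]
          push_cast
          rw [Real.mul_rpow (by positivity) (by positivity), ← Real.rpow_natCast, ← Real.rpow_natCast,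
            ← Real.rpow_mul (by positivity), ← Real.rpow_mul (by positivity)]
          norm_num
      _ = 8 * (k.factorial * 8 ^ k) * ∑ n ∈ s with f n ≠ 0, g (σ n) := by rw [Finset.mul_sum]
      _ ≤ 8 * (k.factorial * 8 ^ k) * ∑' q, g q := by
          gcongr
          rw [← Finset.sum_image (f := g) (g := σ)]
          · exact hgs.sum_le_tsum _ (fun q _ => hg0 q)
          · intro a ha b hb hab
            rw [← hσ a (by simpa using (Finset.mem_filter.mp ha).2), ← hσ b (by simpa using (Finset.mem_filter.mp hb).2), hab]
      _ = _ := by ring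
  exact ⟨summable_of_sum_le hf0 key, Real.tsum_le_of_sum_le hf0 key⟩

open Classical in
/-- primes congruent to one mod d with cofactor coprime to L -/
noncomputable def gd (k : ℕ) (η : ℝ) (L d n : ℕ) : ℝ :=
  if (n : ZMod d) = 1 ∧ n.Prime ∧ ((n - 1) / d).Coprime L then tm k η n else 0

lemma gd_nonneg (k : ℕ) (η : ℝ) (L d n : ℕ) : 0 ≤ gd k η L d n := by
  unfold gd; split_ifs; exacts [tm_nonneg _ _ _, le_rfl]

lemma gd_le (k : ℕ) (η : ℝ) (L d n : ℕ) : gd k η L d n ≤ if (n : ZMod d) = 1 then tm k η n else 0 := by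
  unfold gd
  by_cases h : (n : ZMod d) = 1
  · simp only [h, true_and, if_true]; split_ifs; exacts [le_rfl, tm_nonneg _ _ _]
  · simp [h]

lemma gd_summable (k : ℕ) {η : ℝ} (hη : 0 < η) (L d : ℕ) : Summable (gd k η L d) :=
  (S_hasSum hη d k).1.of_nonneg_of_le (gd_nonneg _ _ _ _) (gd_le _ _ _ _)

lemma gd_pointwise (k : ℕ) (η : ℝ) (Q : Finset ℕ) (hQ : ∀ p ∈ Q, p.Prime) (d : ℕ) (hd : d ∣ ∏ p ∈ Q, p) (n : ℕ) :
    (if (n : ZMod d) = 1 then tm k η n else 0) ≤ gd k η (∏ p ∈ Q, p) d n + 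
      (∑ r ∈ Q, if (n : ZMod (d * r)) = 1 then tm k η n else 0) + (if n.Prime then 0 else tm k η n) := by
  have ht := tm_nonneg k η n
  have h1 := gd_nonneg k η (∏ p ∈ Q, p) d n
  have h2 : 0 ≤ (∑ r ∈ Q, if (n : ZMod (d * r)) = 1 then tm k η n else 0) :=
    Finset.sum_nonneg fun r _ => by split_ifs; exacts [ht, le_rfl]
  by_cases hn : (n : ZMod d) = 1
  swap
  · simp only [hn, if_false]
    have : 0 ≤ (if n.Prime then 0 else tm k η n) := by split_ifs; exacts [le_rfl, ht]
    linarith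
  by_cases hp : n.Prime
  swap
  · simp only [hn, hp, if_true, if_false]; linarith
  by_cases hc : ((n - 1) / d).Coprime (∏ p ∈ Q, p)
  · have : gd k η (∏ p ∈ Q, p) d n = tm k η n := by simp [gd, hn, hp, hc]
    simp only [hn, hp, if_true]; linarith
  · have : ∃ r ∈ Q, ¬ ((n - 1) / d).Coprime r := by
      by_contra! h
      exact hc (Nat.Coprime.prod_right h)
    obtain ⟨r, hr, hrc⟩ := this
    have hrd : r ∣ (n - 1) / d := by
      rw [Nat.coprime_comm] at hrc
      exact (Nat.Prime.dvd_iff_not_coprime (hQ r hr)).mpr hrc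
    have hdn : d ∣ n - 1 := by
      have : ((1 : ℕ) : ZMod d) = n := by simpa using hn.symm
      rw [ZMod.natCast_eq_natCast_iff] at this
      exact (Nat.modEq_iff_dvd' hp.one_lt.le).mp this
    have hdr : d * r ∣ n - 1 := by
      obtain ⟨c, hc⟩ := hrd
      obtain ⟨e, he⟩ := hdn
      have hd0 : 0 < d := Nat.pos_of_dvd_of_pos hd (Finset.prod_pos fun p hp => (hQ p hp).pos)
      rw [he, Nat.mul_div_cancel_left _ hd0] at hc
      rw [he, hc, ← mul_assoc]; exact dvd_mul_right _ _
    have hn' : (n : ZMod (d * r)) = 1 := by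
      have : ((1 : ℕ) : ZMod (d*r)) = n := by
        rw [ZMod.natCast_eq_natCast_iff]
        exact (Nat.modEq_iff_dvd' hp.one_lt.le).mpr hdr
      simpa using this.symm
    have h3 : tm k η n ≤ (∑ r ∈ Q, if (n : ZMod (d * r)) = 1 then tm k η n else 0) := by
      refine le_trans (le_of_eq ?_) (Finset.single_le_sum (f := fun r => if (n : ZMod (d * r)) = 1 then tm k η n else 0) (fun r _ => by split_ifs; exacts [ht, le_rfl]) hr)
      simp [hn']
    simp only [hn, hp, if_true]; linarith

lemma G_lower : ∃ C : ℝ, 0 ≤ C ∧ ∀ (Q : Finset ℕ), (∀ p ∈ Q, p.Prime) → 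
    ∑ p ∈ Q, 1 / ((p:ℝ) - 1) ≤ 1/4 → ∀ η : ℝ, 0 < η → η ≤ 1/16 → 
    (∀ (d : ℕ) [NeZero d], d ∣ (∏ p ∈ Q, p) ^ 2 → HasGood η d) → ∀ k : ℕ, 
    4 * (Q.card + 1 + C) * (∏ p ∈ Q, p : ℕ) ≤ (2:ℝ) ^ k → ∀ d, d ∣ ∏ p ∈ Q, p → 
    k.factorial / (2 * d.totient * η ^ (k+1)) ≤ ∑' n, gd k η (∏ p ∈ Q, p) d n := by
  obtain ⟨C, hC, hnp⟩ := np_bound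
  refine ⟨C, hC, fun Q hQ hsum η hη hη1 hgood k hk d hd => ?_⟩
  set L := ∏ p ∈ Q, p with hL
  have hL0 : 0 < L := Finset.prod_pos fun p hp => (hQ p hp).pos
  have hd0 : 0 < d := Nat.pos_of_dvd_of_pos hd hL0
  have : NeZero d := ⟨hd0.ne'⟩
  obtain ⟨np1, np2⟩ := hnp k η hη
  have hS : ∀ e, Summable (fun n : ℕ => if (n : ZMod e) = 1 then tm k η n else 0) := 
    fun e => (S_hasSum hη e k).1
  have hSr : Summable (fun n : ℕ => ∑ r ∈ Q, if (n : ZMod (d*r)) = 1 then tm k η n else 0) :=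
    summable_sum fun r _ => hS (d * r)
  have hmain : (∑' n : ℕ, if (n : ZMod d) = 1 then tm k η n else 0) ≤ (∑' n, gd k η L d n) + 
      (∑ r ∈ Q, ∑' n : ℕ, if (n : ZMod (d*r)) = 1 then tm k η n else 0) + 
      ∑' n, (if n.Prime then 0 else tm k η n) := by
    rw [← Summable.tsum_finsetSum fun r _ => hS (d * r), ← (gd_summable k hη L d).tsum_add hSr, 
      ← ((gd_summable k hη L d).add hSr).tsum_add np1]
    exact (hS d).tsum_le_tsum (gd_pointwise k η Q hQ d hd) (((gd_summable k hη L d).add hSr).add np1)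
  have hφ : (0:ℝ) < d.totient := by exact_mod_cast Nat.totient_pos.mpr hd0
  have hφL : (d.totient : ℝ) ≤ L := by exact_mod_cast (Nat.totient_le d).trans (Nat.le_of_dvd hL0 hd)
  have ha := (abs_le.mp (S_asymp hη d (hgood d (hd.trans (dvd_pow_self _ two_ne_zero))) k)).1
  have hr : (∑ r ∈ Q, ∑' n : ℕ, if (n : ZMod (d*r)) = 1 then tm k η n else 0) ≤ 
      ∑ r ∈ Q, (k.factorial / (d.totient * η ^ (k+1)) * (1 / ((r:ℝ) - 1)) + k.factorial / (η ^ (k+1) * 2 ^ k)) := by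
    refine Finset.sum_le_sum fun r hr => ?_
    have hrp := hQ r hr
    have : NeZero (d * r) := ⟨(Nat.mul_pos hd0 hrp.pos).ne'⟩
    have := (abs_le.mp (S_asymp hη (d * r) (hgood (d*r) (by rw [sq]; exact mul_dvd_mul hd (Finset.dvd_prod_of_mem _ hr))) k)).2
    have h2 : (d.totient : ℝ) * ((r:ℝ) - 1) ≤ (d * r).totient := by
      have := Nat.totient_super_multiplicative d r
      rw [Nat.totient_prime hrp] at this
      have h3 : ((d.totient * (r - 1) : ℕ) : ℝ) ≤ (d*r).totient := by exact_mod_cast this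
      rwa [Nat.cast_mul, Nat.cast_sub hrp.one_lt.le, Nat.cast_one] at h3
    have hr1 : (0:ℝ) < (r:ℝ) - 1 := by
      have : (1:ℝ) < r := by exact_mod_cast hrp.one_lt
      linarith
    have h4 : (k.factorial:ℝ) / ((d * r).totient * η ^ (k+1)) ≤ k.factorial / (d.totient * η ^ (k+1)) * (1 / ((r:ℝ) - 1)) := by
      rw [div_mul_div_comm, mul_one, mul_right_comm]
      gcongr
    linarith
  rw [Finset.sum_add_distrib, ← Finset.mul_sum, Finset.sum_const, nsmul_eq_mul] at hr
  set F : ℝ := k.factorial / η ^ (k+1) with hF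
  have hF0 : 0 < F := by positivity
  have e1 : (k.factorial:ℝ) / (d.totient * η ^ (k+1)) = F / d.totient := by rw [hF]; field_simp
  have e2 : (k.factorial:ℝ) / (η ^ (k+1) * 2 ^ k) = F / 2 ^ k := by rw [hF]; field_simp
  have e3 : (k.factorial:ℝ) / (2 * d.totient * η ^ (k+1)) = F / d.totient / 2 := by rw [hF]; field_simp
  rw [e1, e2] at ha hr
  rw [e3]
  have h5 : C * (k.factorial * 8 ^ k) ≤ C * (F / 2 ^ k) := by
    gcongr
    rw [hF, div_div, le_div_iff₀ (by positivity)]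
    have : (8:ℝ) ^ k * (η ^ (k+1) * 2 ^ k) ≤ 1 := by
      have : (8:ℝ) ^ k * (η ^ (k+1) * 2 ^ k) = (16 * η) ^ k * η := by
        rw [mul_pow, show (16:ℝ) = 8 * 2 by norm_num, mul_pow]; ring
      rw [this]
      exact mul_le_one₀ (pow_le_one₀ (by positivity) (by linarith)) hη.le (by linarith)
    calc _ = (k.factorial : ℝ) * ((8:ℝ) ^ k * (η ^ (k+1) * 2 ^ k)) := by ring
      _ ≤ k.factorial * 1 := by gcongr
      _ = _ := mul_one _
  have h6 : F / d.totient * (∑ r ∈ Q, 1 / ((r:ℝ) - 1)) ≤ F / d.totient * (1/4) := by gcongr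
  have h7 : (Q.card + 1 + C) * (F / 2 ^ k) ≤ F / d.totient / 4 := by
    clear_value F
    have h8 : (Q.card + 1 + C) * (d.totient * 4) ≤ 2 ^ k := by
      calc _ ≤ (Q.card + 1 + C) * (L * 4) := by gcongr
        _ ≤ _ := by linarith
    rw [← mul_div_assoc, div_div, div_le_div_iff₀ (by positivity) (by positivity)]
    calc _ = F * ((Q.card + 1 + C) * (d.totient * 4)) := by ring
      _ ≤ _ := by gcongr
  linarith

end

section
open ArithmeticFunction

lemma zeta_step {x b : ℝ} (hx : 0 < x) (hb : 1 < b) :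
    b ^ (-(1 + x)) ≤ 1 / x * ((b - 1) ^ (-x) - b ^ (-x)) := by
  have hb0 : 0 < b := by linarith
  have h1 : (b - 1) / b ≤ Real.exp (-(1/b)) := by
    have := Real.add_one_le_exp (-(1/b))
    rw [sub_div, div_self hb0.ne']; linarith
  have h2 : 1 + x / b ≤ ((b - 1) / b) ^ (-x) := by
    calc 1 + x / b ≤ Real.exp (x / b) := by linarith [Real.add_one_le_exp (x / b)]
      _ = (Real.exp (-(1/b))) ^ (-x) := by rw [← Real.exp_mul]; congr 1; ring
      _ ≤ _ := Real.rpow_le_rpow_of_nonpos (div_pos (by linarith) hb0) h1 (by linarith)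
  rw [Real.div_rpow (by linarith) hb0.le, le_div_iff₀ (by positivity)] at h2
  have h3 : b ^ (-(1 + x)) = b ^ (-x) / b := by
    rw [show -(1 + x) = -x - 1 by ring, Real.rpow_sub_one hb0.ne']
  rw [h3]
  have h4 : x * (b ^ (-x) / b) ≤ (b - 1) ^ (-x) - b ^ (-x) := by
    have : (1 + x / b) * b ^ (-x) = b ^ (-x) + x * (b ^ (-x) / b) := by ring
    linarith
  rw [one_div, inv_mul_eq_div, le_div_iff₀ hx]; linarith

lemma zeta_partial {x : ℝ} (hx : 0 < x) (N : ℕ) :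
    ∑ i ∈ Finset.range (N + 2), (i : ℝ) ^ (-(1 + x)) ≤ 1 + 1 / x * (1 - ((N:ℝ) + 1) ^ (-x)) := by
  induction N with
  | zero => simp [Finset.sum_range_succ]; rw [Real.zero_rpow (by linarith)]
  | succ N ih =>
    rw [Finset.sum_range_succ]
    have := zeta_step hx (b := ((N + 2 : ℕ) : ℝ)) (by push_cast; have : (0:ℝ) ≤ N := Nat.cast_nonneg N; linarith)
    have e : ((N + 2 : ℕ) : ℝ) - 1 = N + 1 := by push_cast; ring
    rw [e] at this
    have e2 : (((N + 1 : ℕ) : ℝ) + 1) = ((N + 2 : ℕ) : ℝ) := by push_cast; ring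
    have e3 : (N + 1 + 1 : ℕ) = N + 2 := rfl
    rw [e2, e3]
    have e4 : 1 / x * (1 - ((N + 2 : ℕ):ℝ) ^ (-x)) = 1 / x * (1 - ((N:ℝ) + 1) ^ (-x)) + 1 / x * (((N:ℝ) + 1) ^ (-x) - ((N + 2 : ℕ):ℝ) ^ (-x)) := by ring
    linarith

lemma zeta_bound {x : ℝ} (hx : 0 < x) (hx1 : x ≤ 1) :
    Summable (fun m : ℕ => (m : ℝ) ^ (-(1 + x))) ∧ ∑' m : ℕ, (m : ℝ) ^ (-(1 + x)) ≤ 2 / x := by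
  refine ⟨by rw [Real.summable_nat_rpow]; linarith, Real.tsum_le_of_sum_range_le (fun _ => by positivity) fun n => ?_⟩
  calc _ ≤ ∑ i ∈ Finset.range (n + 2), (i : ℝ) ^ (-(1 + x)) := 
        Finset.sum_le_sum_of_subset_of_nonneg (by simp) (fun _ _ _ => by positivity)
    _ ≤ _ := zeta_partial hx n
    _ ≤ 1 / x + 1 / x * 1 := by
        have : 1 ≤ 1 / x := by rw [le_div_iff₀ hx]; linarith
        have h : 0 ≤ ((n:ℝ) + 1) ^ (-x) := by positivity
        gcongr; linarith
    _ = _ := by ring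

lemma pow_K_bound (K : ℕ) (hK : 2 ≤ K) : 1 ≤ 8 * (1 - 1 / (K:ℝ)) ^ K := by
  have hK' : (2:ℝ) ≤ K := by exact_mod_cast hK
  have h1 : (1 - 1/(K:ℝ)) * (1 + 1 / ((K:ℝ) - 1)) = 1 := by
    have : (K:ℝ) - 1 ≠ 0 := by linarith
    field_simp; ring
  have h2 : (1 + 1 / ((K:ℝ) - 1)) ^ K ≤ 8 := by
    calc _ ≤ (Real.exp (1 / ((K:ℝ) - 1))) ^ K := by
          have : 0 ≤ 1 / ((K:ℝ) - 1) := by apply div_nonneg <;> linarith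
          gcongr
          linarith [Real.add_one_le_exp (1 / ((K:ℝ) - 1))]
      _ = Real.exp (K * (1 / ((K:ℝ) - 1))) := by rw [← Real.exp_nat_mul]
      _ ≤ Real.exp 2 := by
          gcongr
          rw [mul_one_div, div_le_iff₀ (by linarith)]; linarith
      _ = Real.exp 1 ^ 2 := by rw [← Real.exp_nat_mul]; norm_num
      _ ≤ 2.7182818286 ^ 2 := by gcongr; exact Real.exp_one_lt_d9.le
      _ ≤ 8 := by norm_num
  have h3 : 0 ≤ (1 - 1/(K:ℝ)) ^ K := by
    apply pow_nonneg
    rw [sub_nonneg, div_le_one (by linarith)]; linarith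
  calc (1:ℝ) = (1 - 1/(K:ℝ)) ^ K * (1 + 1 / ((K:ℝ) - 1)) ^ K := by rw [← mul_pow, h1, one_pow]
    _ ≤ (1 - 1/(K:ℝ)) ^ K * 8 := by gcongr
    _ = _ := mul_comm _ _

lemma w_bound {η R : ℝ} (hη : 0 < η) (hR : 1 ≤ R) (hRη : η * Real.log (4 * R) ≤ 1/2) (K : ℕ) (hK : 2 ≤ K) (m : ℕ) :
    Real.log (4 * R * m) ^ K * (m:ℝ) ^ (-(1+η)) ≤ 16 * K.factorial / η ^ K * (m:ℝ) ^ (-(1 + η / K)) := by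
  rcases Nat.eq_zero_or_pos m with rfl | hm
  · simp [show K ≠ 0 by omega]; positivity
  have hm1 : (1:ℝ) ≤ m := by exact_mod_cast hm
  have hm0 : (0:ℝ) < m := by linarith
  have hK' : (2:ℝ) ≤ K := by exact_mod_cast hK
  set b := 1 - 1 / (K:ℝ) with hb
  have hb0 : 0 < b := by rw [hb, sub_pos, div_lt_one (by linarith)]; linarith
  have hb1 : b ≤ 1 := by rw [hb]; have : 0 ≤ 1 / (K:ℝ) := by positivity
                         linarith
  have h1 := log_pow_le K (a := η * b) (u := 4 * R * m) (by positivity) (by nlinarith)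
  have hl : 0 ≤ Real.log (4 * R) := Real.log_nonneg (by linarith)
  have h2 : (4 * R) ^ (η * b) ≤ 2 := by
    rw [Real.rpow_def_of_pos (by linarith)]
    have : Real.log (4 * R) * (η * b) ≤ 1/2 := by nlinarith [mul_nonneg hl hη.le]
    calc _ ≤ Real.exp (1/2) := by gcongr
      _ ≤ 2 := by
        have h := Real.exp_one_lt_d9
        have h' : Real.exp (1/2) ^ 2 = Real.exp 1 := by rw [← Real.exp_nat_mul]; norm_num
        have := Real.exp_pos (1/2)
        nlinarith
  have h3 := pow_K_bound K hK
  rw [← hb] at h3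
  calc _ ≤ (K.factorial / (η * b) ^ K * (4 * R * m) ^ (η * b)) * (m:ℝ) ^ (-(1+η)) := by gcongr
    _ = (K.factorial / η ^ K) * (1 / b ^ K) * (4 * R) ^ (η * b) * ((m:ℝ) ^ (η * b) * (m:ℝ) ^ (-(1+η))) := by
        rw [Real.mul_rpow (by linarith) hm0.le, mul_pow]; field_simp
    _ ≤ (K.factorial / η ^ K) * 8 * 2 * ((m:ℝ) ^ (η * b) * (m:ℝ) ^ (-(1+η))) := by
        gcongr
        rw [div_le_iff₀ (by positivity)]; exact h3
    _ = _ := by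
        rw [← Real.rpow_add hm0, show η * b + -(1+η) = -(1 + η / K) by rw [hb]; ring]; ring

lemma gd_shift (k : ℕ) (η : ℝ) (L d : ℕ) (hd : 0 < d) :
    ∑' n, gd k η L d n = ∑' m, gd k η L d (d * m + 1) := by
  have hinj : Function.Injective (fun m : ℕ => d * m + 1) := by
    intro a b h
    simp only [add_left_inj] at h
    exact Nat.eq_of_mul_eq_mul_left hd h
  refine (hinj.tsum_eq (f := gd k η L d) ?_).symm
  intro n hn
  have hn' : (n : ZMod d) = 1 ∧ n.Prime ∧ ((n - 1) / d).Coprime L := by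
    by_contra h
    simp [gd, h] at hn
  obtain ⟨h1, hp, -⟩ := hn'
  have hdn : d ∣ n - 1 := by
    have : ((1 : ℕ) : ZMod d) = n := by simpa using h1.symm
    rw [ZMod.natCast_eq_natCast_iff] at this
    exact (Nat.modEq_iff_dvd' hp.one_lt.le).mp this
  obtain ⟨c, hc⟩ := hdn
  exact ⟨c, by have := hp.one_lt; simp only; omega⟩

open Classical in
lemma gd_term (k : ℕ) {η : ℝ} (hη : 0 < η) (L d R : ℕ) (hd : 0 < d) (hdR : d ≤ R) (m : ℕ) :
    (d:ℝ) * gd k η L d (d * m + 1) ≤ if 0 < m ∧ m.Coprime L ∧ (d * m + 1).Prime then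
      Real.log (4 * R * m) ^ (k+1) * (m:ℝ) ^ (-(1+η)) else 0 := by
  rcases Nat.eq_zero_or_pos m with rfl | hm
  · simp [gd, Nat.not_prime_one]
  by_cases hp : (d * m + 1).Prime
  swap
  · simp [gd, hp]
  by_cases hc : m.Coprime L
  swap
  · simp [gd, hc, Nat.mul_div_cancel_left _ hd]
  rw [if_pos ⟨hm, hc, hp⟩]
  have hm1 : (1:ℝ) ≤ m := by exact_mod_cast hm
  have hd1 : (1:ℝ) ≤ d := by exact_mod_cast hd
  have hdR' : (d:ℝ) ≤ R := by exact_mod_cast hdR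
  have h1 : gd k η L d (d * m + 1) ≤ tm k η (d * m + 1) := by
    unfold gd; split_ifs; exacts [le_rfl, tm_nonneg _ _ _]
  have h2 : tm k η (d * m + 1) = Real.log ((d:ℝ) * m + 1) ^ (k+1) * ((d:ℝ) * m + 1) ^ (-(1+η)) := by
    unfold tm
    rw [vonMangoldt_apply_prime hp, Real.rpow_neg (by positivity), div_eq_mul_inv]
    push_cast; ring
  have h3 : ((d:ℝ) * m + 1) ^ (-(1+η)) ≤ ((d:ℝ) * m) ^ (-(1+η)) :=
    Real.rpow_le_rpow_of_nonpos (by positivity) (by linarith) (by linarith)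
  have hdm : (1:ℝ) ≤ d * m := by nlinarith
  have h4 : Real.log ((d:ℝ) * m + 1) ≤ Real.log (4 * R * m) := by
    apply Real.log_le_log (by positivity)
    nlinarith [mul_le_mul_of_nonneg_right hdR' (by linarith : (0:ℝ) ≤ m)]
  have h5 : 0 ≤ Real.log ((d:ℝ) * m + 1) := Real.log_nonneg (by linarith)
  calc _ ≤ (d:ℝ) * (Real.log (4 * R * m) ^ (k+1) * ((d:ℝ) * m) ^ (-(1+η))) := by
        rw [h2] at h1
        have h6 : 0 ≤ Real.log (4 * R * m) := h5.trans h4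
        gcongr
        exact h1.trans (by gcongr)
    _ = Real.log (4 * R * m) ^ (k+1) * (m:ℝ) ^ (-(1+η)) * ((d:ℝ) * (d:ℝ) ^ (-(1+η))) := by
        rw [Real.mul_rpow (by linarith) (by linarith)]; ring
    _ ≤ Real.log (4 * R * m) ^ (k+1) * (m:ℝ) ^ (-(1+η)) * 1 := by
        have : 0 ≤ Real.log (4 * R * m) := h5.trans h4
        gcongr
        rw [show (d:ℝ) * (d:ℝ) ^ (-(1+η)) = (d:ℝ) ^ (1:ℝ) * (d:ℝ) ^ (-(1+η)) by rw [Real.rpow_one], ← Real.rpow_add (by linarith)]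
        apply Real.rpow_le_one_of_one_le_of_nonpos hd1; linarith
    _ = _ := mul_one _

lemma pigeon (k L R : ℕ) {η T : ℝ} (hη : 0 < η) (hη1 : η ≤ 1) (hL : 0 < L) (hLR : L ≤ R) (hT : 0 < T)
    (hRη : η * Real.log (4 * R) ≤ 1/2)
    (hlow : ∀ d, d ∣ L → k.factorial / (2 * d.totient * η ^ (k+1)) ≤ ∑' n, gd k η L d n)
    (hN : ∀ m : ℕ, 0 < m → m.Coprime L → ((L.divisors.filter (fun d => (d * m + 1).Prime)).card : ℝ) ≤ T * Real.log (4 * R * m)) :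
    (L.divisors.card : ℝ) ≤ 64 * T * (k+2) ^ 3 / η ^ 2 := by
  classical
  have hR1 : (1:ℝ) ≤ R := by exact_mod_cast hL.trans_le hLR
  set K := k + 2 with hK
  have hK0 : (0:ℝ) < K := by positivity
  have hK2 : (2:ℝ) ≤ K := by rw [hK]; push_cast; linarith [(Nat.cast_nonneg k : (0:ℝ) ≤ k)]
  obtain ⟨zs, zb⟩ := zeta_bound (x := η / K) (by positivity) (by rw [div_le_one hK0]; linarith)
  have hpos : ∀ d ∈ L.divisors, 0 < d := fun d hd => Nat.pos_of_mem_divisors hd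
  have hsm : ∀ d ∈ L.divisors, Summable (fun m => (d:ℝ) * gd k η L d (d * m + 1)) := by
    intro d hd
    refine ((gd_summable k hη L d).comp_injective (i := fun m : ℕ => d * m + 1) ?_).mul_left _
    intro a b h
    simp only [add_left_inj] at h
    exact Nat.eq_of_mul_eq_mul_left (hpos d hd) h
  have h1 : (L.divisors.card : ℝ) * (k.factorial / (2 * η ^ (k+1))) ≤ 
      ∑ d ∈ L.divisors, ∑' m, (d:ℝ) * gd k η L d (d * m + 1) := by
    rw [← nsmul_eq_mul, ← Finset.sum_const]
    refine Finset.sum_le_sum fun d hd => ?_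
    rw [tsum_mul_left, ← gd_shift k η L d (hpos d hd)]
    have h := hlow d (Nat.dvd_of_mem_divisors hd)
    have hφ : (0:ℝ) < d.totient := by exact_mod_cast Nat.totient_pos.mpr (hpos d hd)
    have hφd : (d.totient:ℝ) ≤ d := by exact_mod_cast Nat.totient_le d
    calc (k.factorial:ℝ) / (2 * η ^ (k+1)) = d.totient * (k.factorial / (2 * d.totient * η ^ (k+1))) := by
          field_simp
      _ ≤ d * ∑' n, gd k η L d n := by gcongr
  rw [← Summable.tsum_finsetSum hsm] at h1
  have h2 : ∀ m : ℕ, ∑ d ∈ L.divisors, (d:ℝ) * gd k η L d (d * m + 1) ≤ 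
      T * (16 * K.factorial / η ^ K) * (m:ℝ) ^ (-(1 + η / K)) := by
    intro m
    have hrhs : 0 ≤ T * (16 * K.factorial / η ^ K) * (m:ℝ) ^ (-(1 + η / K)) := by positivity
    have h3 := Finset.sum_le_sum fun d (hd : d ∈ L.divisors) => gd_term k hη L d R (hpos d hd) 
      ((Nat.divisor_le hd).trans hLR) m
    refine h3.trans ?_
    by_cases hm : 0 < m ∧ m.Coprime L
    · have hm1 : (1:ℝ) ≤ m := by exact_mod_cast hm.1
      have hl : 0 ≤ Real.log (4 * R * m) := Real.log_nonneg (by nlinarith)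
      simp only [hm.1, true_and]
      rw [← Finset.sum_filter, Finset.sum_const, nsmul_eq_mul]
      calc _ ≤ T * Real.log (4 * R * m) * (Real.log (4 * R * m) ^ (k+1) * (m:ℝ) ^ (-(1+η))) := by
            gcongr
            refine le_trans (Nat.cast_le.mpr (Finset.card_le_card ?_)) (hN m hm.1 hm.2)
            intro a ha
            rw [Finset.mem_filter] at ha ⊢
            exact ⟨ha.1, ha.2.2⟩
        _ = T * (Real.log (4 * R * m) ^ K * (m:ℝ) ^ (-(1+η))) := by rw [hK]; ring
        _ ≤ T * (16 * K.factorial / η ^ K * (m:ℝ) ^ (-(1 + η / K))) := by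
            refine mul_le_mul_of_nonneg_left ?_ hT.le
            exact w_bound hη hR1 hRη K (by omega) m
        _ = _ := by ring
    · refine le_trans (le_of_eq (Finset.sum_eq_zero fun d _ => ?_)) hrhs
      rw [if_neg]; tauto
  have h4 := (summable_sum hsm).tsum_le_tsum h2 (zs.mul_left _)
  rw [tsum_mul_left] at h4
  have h5 : (L.divisors.card : ℝ) * (k.factorial / (2 * η ^ (k+1))) ≤ T * (16 * K.factorial / η ^ K) * (2 / (η / K)) :=
    h1.trans (h4.trans (by gcongr))
  have e : (K.factorial : ℝ) = K * (k+1) * k.factorial := by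
    rw [hK, Nat.factorial_succ, Nat.factorial_succ]; push_cast; ring
  have hfac : (0:ℝ) < k.factorial := by positivity
  have h6 : T * (16 * K.factorial / η ^ K) * (2 / (η / K)) = (64 * T * (K * (k+1) * K) / η ^ 2) * (k.factorial / (2 * η ^ (k+1))) := by
    rw [e]; field_simp; rw [hK]; ring
  rw [h6] at h5
  have h7 := le_of_mul_le_mul_right h5 (by positivity)
  refine h7.trans ?_
  have e2 : (k:ℝ) + 2 = K := by rw [hK]; push_cast; ring
  rw [e2]
  gcongr
  have : (k:ℝ) + 1 ≤ K := by linarith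
  calc (K:ℝ) * (k+1) * K ≤ K * K * K := by gcongr
    _ = _ := by ring

end

section
open ArithmeticFunction

lemma two_pow_card_le_divisors (Q : Finset ℕ) (hQ : ∀ p ∈ Q, p.Prime) :
    2 ^ Q.card ≤ (∏ p ∈ Q, p).divisors.card := by
  rw [← Finset.card_powerset]
  refine Finset.card_le_card_of_injOn (fun S => ∏ p ∈ S, p) ?_ ?_
  · intro S hS
    have hS' : S ⊆ Q := by simpa using hS
    simp only [Finset.mem_coe, Nat.mem_divisors]
    exact ⟨Finset.prod_dvd_prod_of_subset _ _ _ hS', (Finset.prod_pos fun p hp => (hQ p hp).pos).ne'⟩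
  · intro S hS S' hS' h
    have h1 : S ⊆ Q := by simpa using hS
    have h2 : S' ⊆ Q := by simpa using hS'
    rw [← Nat.primeFactors_prod (fun p hp => hQ p (h1 hp)), ← Nat.primeFactors_prod (fun p hp => hQ p (h2 hp))]
    simp only at h
    rw [h]

lemma two_pow_card_le_prod (Q : Finset ℕ) (hQ : ∀ p ∈ Q, p.Prime) : 2 ^ Q.card ≤ ∏ p ∈ Q, p :=
  Finset.pow_card_le_prod _ _ _ (fun p hp => (hQ p hp).two_le)

lemma HasGood.mono {η η' : ℝ} (h0 : 0 < η') (h : η' ≤ η) {d : ℕ} [NeZero d] (H : HasGood η d) : HasGood η' d := by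
  intro s hs
  have h1 : 1 / η ≤ 1 / η' := one_div_le_one_div_of_le h0 h
  obtain ⟨⟨a, b⟩, c⟩ := H s (hs.trans (by linarith))
  exact ⟨⟨a, b.trans h1⟩, fun χ hχ => ⟨(c χ hχ).1, (c χ hχ).2.trans h1⟩⟩

theorem prachar : ∃ C : ℝ, 1 ≤ C ∧ ∃ A : ℕ, ∀ Q : Finset ℕ, (∀ p ∈ Q, p.Prime) →
    ∑ p ∈ Q, 1 / ((p:ℝ) - 1) ≤ 1/4 → ∃ Q' ⊆ Q, ∃ m : ℕ, 0 < m ∧ m.Coprime (∏ p ∈ Q', p) ∧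
    (2:ℝ) ^ Q.card * Real.log (4 * (∏ p ∈ Q, p : ℕ) * m) ≤ C * Real.log (4 * (∏ p ∈ Q, p : ℕ)) ^ A * 
      (((∏ p ∈ Q', p).divisors.filter (fun d => (d * m + 1).Prime)).card : ℝ) := by
  obtain ⟨C0, hC0, hgs⟩ := good_subset
  obtain ⟨C5, hC5, hG⟩ := G_lower
  set b := Real.log (2 + C5) with hb
  have hb0 : 0 ≤ b := Real.log_nonneg (by linarith)
  set D : ℝ := 64 * (7 + 2 * b) ^ 3 * (16 * C0) ^ 2 * 2 ^ 24 with hD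
  have hD1 : 1 ≤ D := by
    have h1 : 1 ≤ (7 + 2 * b) ^ 3 := one_le_pow₀ (by linarith)
    have h2 : 1 ≤ (16 * C0) ^ 2 := one_le_pow₀ (by linarith)
    rw [hD]
    nlinarith [one_le_mul_of_one_le_of_one_le h1 h2]
  refine ⟨4 * D, by linarith, 27, fun Q hQ hsum => ?_⟩
  set R := ∏ p ∈ Q, p with hR
  have hR0 : 0 < R := Finset.prod_pos fun p hp => (hQ p hp).pos
  have hR1 : (1:ℝ) ≤ R := by exact_mod_cast hR0
  set l := Real.log (4 * R) with hl
  have hl1 : 1 ≤ l := by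
    have : Real.log 4 ≤ l := Real.log_le_log (by norm_num) (by linarith)
    have h2 : Real.log 4 = 2 * Real.log 2 := by
      rw [show (4:ℝ) = 2 ^ 2 by norm_num, Real.log_pow]; norm_num
    linarith [Real.log_two_gt_d9]
  obtain ⟨Q', hQ', hcard, hgood⟩ := hgs Q hQ hsum (2 * l) (by linarith) (by
    have : Real.log R ≤ l := Real.log_le_log (by linarith) (by linarith)
    linarith)
  have hQp : ∀ p ∈ Q', p.Prime := fun p hp => hQ p (hQ' hp)
  refine ⟨Q', hQ', ?_⟩
  set L := ∏ p ∈ Q', p with hL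
  have hL0 : 0 < L := Finset.prod_pos fun p hp => (hQp p hp).pos
  have hLR : L ≤ R := Nat.le_of_dvd hR0 (Finset.prod_dvd_prod_of_subset _ _ _ hQ')
  by_contra! hcon
  set η : ℝ := 1 / (16 * C0 * (2 * l) ^ 12) with hη
  have hl12 : 2 * l ≤ (2 * l) ^ 12 := le_self_pow₀ (by linarith) (by norm_num)
  have hη0 : 0 < η := by positivity
  have hη16 : η ≤ 1 / 16 := by
    rw [hη]
    apply one_div_le_one_div_of_le (by norm_num)
    nlinarith
  have hηl : η * l ≤ 1 / 2 := by
    rw [hη, one_div_mul_eq_div, div_le_iff₀ (by positivity)]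
    nlinarith
  have hηη : η ≤ 1 / (C0 * (2 * l) ^ 12) := by
    rw [hη]
    apply one_div_le_one_div_of_le (by positivity)
    have : 0 ≤ C0 * (2 * l) ^ 12 := by positivity
    linarith
  have hgood' : ∀ (d : ℕ) [NeZero d], d ∣ (∏ p ∈ Q', p) ^ 2 → HasGood η d := by
    intro d _ hd
    refine HasGood.mono hη0 hηη ?_
    intro s hs
    have := hgood d hd s hs
    rwa [one_div_one_div]
  set k := ⌈4 * l + 2 * b⌉₊ with hk
  have hk1 : 4 * l + 2 * b ≤ k := Nat.le_ceil _
  have hk2 : (k:ℝ) ≤ 4 * l + 2 * b + 1 := (Nat.ceil_lt_add_one (by positivity)).le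
  have hkk : (k:ℝ) + 2 ≤ (7 + 2 * b) * l := by nlinarith
  have h2k : 4 * (Q'.card + 1 + C5) * (L:ℝ) ≤ (2:ℝ) ^ k := by
    have h1 : (Q'.card : ℝ) ≤ R := by
      have : Q'.card < 2 ^ Q'.card := Nat.lt_two_pow_self
      have h3 := two_pow_card_le_prod Q' hQp
      exact_mod_cast (this.le.trans h3).trans hLR
    have h2 : (L:ℝ) ≤ R := by exact_mod_cast hLR
    calc 4 * (Q'.card + 1 + C5) * (L:ℝ) ≤ 4 * (R + R + C5 * R) * R := by
          gcongr
          nlinarith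
      _ = 4 * (2 + C5) * (R * R) := by ring
      _ ≤ (4 * R) * (4 * R) * (2 + C5) := by nlinarith [mul_pos (by linarith : (0:ℝ) < R) (by linarith : (0:ℝ) < R), mul_nonneg hC5 (mul_self_nonneg (R:ℝ))]
      _ = Real.exp (2 * l + b) := by
          rw [Real.exp_add, hb, Real.exp_log (by linarith), two_mul, Real.exp_add, hl, Real.exp_log (by linarith)]
      _ ≤ Real.exp (k * Real.log 2) := by
          gcongr
          have := Real.log_two_gt_d9
          nlinarith
      _ = _ := by rw [mul_comm, Real.exp_mul, Real.exp_log (by norm_num), Real.rpow_natCast]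
  have hsum' : ∑ p ∈ Q', 1 / ((p:ℝ) - 1) ≤ 1/4 := by
    refine le_trans (Finset.sum_le_sum_of_subset_of_nonneg hQ' fun p hp _ => ?_) hsum
    have : (1:ℝ) < p := by exact_mod_cast (hQ p hp).one_lt
    apply div_nonneg <;> linarith
  have hlow := hG Q' hQp hsum' η hη0 hη16 hgood' k h2k
  set T : ℝ := 2 ^ Q.card / (4 * D * l ^ 27) with hT
  have hl0 : 0 < l := by linarith
  have hD0 : 0 < D := by linarith
  have hpg := pigeon k L R (T := T) hη0 (by linarith) hL0 hLR (by positivity) hηl hlow (by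
    intro m hm hc
    have := hcon m hm hc
    rw [hT, div_mul_eq_mul_div, le_div_iff₀ (by positivity)]
    linarith)
  have h1 : ((2 ^ Q'.card : ℕ) : ℝ) ≤ L.divisors.card := by exact_mod_cast two_pow_card_le_divisors Q' hQp
  have h2 : 64 * T * ((k:ℝ)+2) ^ 3 / η ^ 2 ≤ 2 ^ Q.card / 4 := by
    calc _ ≤ 64 * T * ((7 + 2 * b) * l) ^ 3 / η ^ 2 := by gcongr
      _ = _ := by
        have h3 : 7 + 2 * b ≠ 0 := by linarith
        have h4 : C0 ≠ 0 := by linarith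
        rw [hT, hη, hD]; field_simp
  have h3 : (2:ℝ) ^ Q.card ≤ 2 * 2 ^ Q'.card := by
    rw [← pow_succ']
    exact pow_le_pow_right₀ (by norm_num) hcard
  have h4 : (0:ℝ) < 2 ^ Q'.card := by positivity
  push_cast at h1
  linarith

end

section
lemma poly_le_two_pow (K : ℝ) (a : ℕ) : ∀ᶠ w : ℕ in Filter.atTop, K * (w:ℝ) ^ a ≤ 2 ^ w := by
  have h := (tendsto_pow_const_div_const_pow_of_one_lt a (r := (2:ℝ)) (by norm_num)).const_mul K
  rw [mul_zero] at h
  filter_upwards [h.eventually_le_const (show (0:ℝ) < 1 by norm_num)] with w hw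
  rw [← mul_div_assoc, div_le_one (by positivity)] at hw
  exact hw

lemma step0 : ∃ r : ℕ → ℕ, StrictMono r ∧ ∀ i, (r i).Prime ∧ 2 ^ (i+10) < r i ∧ r i ≤ 2 ^ (i+11) := by
  have : ∀ i : ℕ, ∃ p : ℕ, p.Prime ∧ 2 ^ (i+10) < p ∧ p ≤ 2 ^ (i+11) := by
    intro i
    obtain ⟨p, h1, h2, h3⟩ := Nat.exists_prime_lt_and_le_two_mul (2 ^ (i+10)) (by positivity)
    exact ⟨p, h1, h2, by rw [show i + 11 = (i+10)+1 by ring, pow_succ]; omega⟩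
  choose r hr using this
  refine ⟨r, strictMono_nat_of_lt_succ fun i => ?_, hr⟩
  have h1 := (hr i).2.2
  have h2 := (hr (i+1)).2.1
  rw [show i + 1 + 10 = i + 11 by ring] at h2
  omega

lemma log4_ge {R : ℕ} (hR : 0 < R) : 1 ≤ Real.log (4 * R) := by
  have hR1 : (1:ℝ) ≤ R := by exact_mod_cast hR
  have : Real.log 4 ≤ Real.log (4 * R) := Real.log_le_log (by norm_num) (by linarith)
  have h2 : Real.log 4 = 2 * Real.log 2 := by
    rw [show (4:ℝ) = 2 ^ 2 by norm_num, Real.log_pow]; norm_num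
  linarith [Real.log_two_gt_d9]

lemma step1 (H : ℝ) (hH : 1 ≤ H) : ∃ M : ℕ, 0 < M ∧ ∃ P : Finset ℕ, (∀ q ∈ P, q.Prime ∧ q - 1 ∣ M) ∧
    H * Real.log (4 * M) ≤ P.card := by
  classical
  obtain ⟨C, hC, A, hP⟩ := prachar
  obtain ⟨r, hmono, hr⟩ := step0
  obtain ⟨w, hw, hw1⟩ := ((poly_le_two_pow (C * H * 14 ^ A) (2 * A)).and (Filter.eventually_ge_atTop 1)).exists
  set Q := (Finset.range w).image r with hQd
  have hQc : Q.card = w := by rw [hQd, Finset.card_image_of_injective _ hmono.injective, Finset.card_range]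
  have hQ : ∀ p ∈ Q, p.Prime := by
    intro p hp
    obtain ⟨i, -, rfl⟩ := Finset.mem_image.mp hp
    exact (hr i).1
  have hsum : ∑ p ∈ Q, 1 / ((p:ℝ) - 1) ≤ 1/4 := by
    rw [hQd, Finset.sum_image hmono.injective.injOn]
    calc _ ≤ ∑ i ∈ Finset.range w, (1/2^10) * (1/2:ℝ) ^ i := by
          refine Finset.sum_le_sum fun i _ => ?_
          have : (2:ℝ) ^ (i+10) + 1 ≤ r i := by exact_mod_cast (hr i).2.1
          calc 1 / ((r i:ℝ) - 1) ≤ 1 / 2 ^ (i+10) := one_div_le_one_div_of_le (by positivity) (by linarith)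
            _ = _ := by rw [pow_add, one_div_pow]; field_simp
      _ = (1/2^10) * ∑ i ∈ Finset.range w, (1/2:ℝ) ^ i := by rw [Finset.mul_sum]
      _ ≤ (1/2^10) * 2 := by gcongr; exact sum_geometric_two_le w
      _ ≤ 1/4 := by norm_num
  obtain ⟨Q', hQ', m, hm, hcop, hmain⟩ := hP Q hQ hsum
  set R := ∏ p ∈ Q, p with hR
  have hR0 : 0 < R := Finset.prod_pos fun p hp => (hQ p hp).pos
  have hl1 := log4_ge hR0
  have hlw : Real.log (4 * R) ≤ 14 * (w:ℝ) ^ 2 := by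
    have h1 : R ≤ 2 ^ ((w + 11) * w) := by
      rw [hR, hQd, Finset.prod_image hmono.injective.injOn, pow_mul]
      calc _ ≤ ∏ i ∈ Finset.range w, 2 ^ (w + 11) := by
            refine Finset.prod_le_prod' fun i hi => ?_
            exact (hr i).2.2.trans (Nat.pow_le_pow_right (by norm_num) (by have := Finset.mem_range.mp hi; omega))
        _ = _ := by simp
    have h2 : 4 * (R:ℝ) ≤ 2 ^ ((w + 11) * w + 2) := by
      have : (R:ℝ) ≤ 2 ^ ((w + 11) * w) := by exact_mod_cast h1
      rw [pow_add]; linarith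
    have h3 := Real.log_le_log (by positivity) h2
    rw [Real.log_pow] at h3
    have hw' : (1:ℝ) ≤ w := by exact_mod_cast hw1
    have := Real.log_two_lt_d9
    have h4 : (((w + 11) * w + 2 : ℕ) : ℝ) * Real.log 2 ≤ (((w + 11) * w + 2 : ℕ) : ℝ) * 1 := by
      gcongr; linarith
    push_cast at h3 h4
    nlinarith
  refine ⟨R * m, Nat.mul_pos hR0 hm, ((∏ p ∈ Q', p).divisors.filter (fun d => (d * m + 1).Prime)).image (fun d => d * m + 1), ?_, ?_⟩
  · intro q hq
    obtain ⟨d, hd, rfl⟩ := Finset.mem_image.mp hq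
    rw [Finset.mem_filter] at hd
    refine ⟨hd.2, ?_⟩
    rw [Nat.add_sub_cancel]
    exact mul_dvd_mul_right ((Nat.dvd_of_mem_divisors hd.1).trans (Finset.prod_dvd_prod_of_subset _ _ _ hQ')) _
  · rw [Finset.card_image_of_injective _ (by
      intro a b h
      simp only [add_left_inj] at h
      exact Nat.eq_of_mul_eq_mul_right hm h)]
    set N : ℝ := (((∏ p ∈ Q', p).divisors.filter (fun d => (d * m + 1).Prime)).card : ℝ) with hN
    rw [hQc] at hmain
    have hl : 0 < C * Real.log (4 * R) ^ A := by positivity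
    have e : (4:ℝ) * ((R * m : ℕ) : ℝ) = 4 * R * m := by push_cast; ring
    rw [e]
    have hlog0 : 0 ≤ Real.log (4 * R * m) := by
      rw [← e]; have := log4_ge (Nat.mul_pos hR0 hm); linarith
    have h5 : C * H * Real.log (4 * R) ^ A ≤ 2 ^ w := by
      refine le_trans ?_ hw
      calc C * H * Real.log (4 * R) ^ A ≤ C * H * (14 * (w:ℝ) ^ 2) ^ A := by gcongr
        _ = _ := by rw [mul_pow, ← pow_mul]; ring
    have h6 : (C * Real.log (4 * R) ^ A) * (H * Real.log (4 * R * m)) ≤ (C * Real.log (4 * R) ^ A) * N := by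
      refine le_trans ?_ hmain
      calc _ = C * H * Real.log (4 * R) ^ A * Real.log (4 * R * m) := by ring
        _ ≤ _ := by gcongr
    exact le_of_mul_le_mul_left h6 hl

lemma step2 (H : ℝ) (hH : 1 ≤ H) (t0 : ℕ) : ∃ M : ℕ, 0 < M ∧ ∃ Q : Finset ℕ, (∀ q ∈ Q, q.Prime ∧ q - 1 ∣ M) ∧
    ∑ p ∈ Q, 1 / ((p:ℝ) - 1) ≤ 1/4 ∧ H * Real.log (4 * M) ≤ Q.card ∧ t0 ≤ Q.card := by
  classical
  obtain ⟨M, hM, P, hP, hc⟩ := step1 (5 * H + 5 * t0 + 6) (by have : (0:ℝ) ≤ t0 := Nat.cast_nonneg _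
                                                              linarith)
  have hl := log4_ge hM
  set l := Real.log (4 * M) with hl'
  set t := ⌈H * l⌉₊ + t0 with ht
  have ht1 : H * l ≤ ⌈H * l⌉₊ := Nat.le_ceil _
  have ht2 : (⌈H * l⌉₊:ℝ) < H * l + 1 := Nat.ceil_lt_add_one (by positivity)
  have htc : 5 * t + 1 ≤ P.card := by
    have : ((5 * t + 1 : ℕ) : ℝ) ≤ P.card := by
      refine le_trans ?_ hc
      rw [ht]; push_cast
      have : (0:ℝ) ≤ t0 := Nat.cast_nonneg _
      nlinarith
    exact_mod_cast this
  have h1 : t ≤ (P \ Finset.range (4 * t + 1)).card := by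
    have := Finset.le_card_sdiff (Finset.range (4 * t + 1)) P
    rw [Finset.card_range] at this
    omega
  obtain ⟨Q, hQ, hQc⟩ := Finset.exists_subset_card_eq h1
  refine ⟨M, hM, Q, fun q hq => hP q (Finset.mem_sdiff.mp (hQ hq)).1, ?_, ?_, by omega⟩
  · have hb : ∀ q ∈ Q, 4 * (t:ℝ) ≤ (q:ℝ) - 1 := by
      intro q hq
      have := (Finset.mem_sdiff.mp (hQ hq)).2
      rw [Finset.mem_range, not_lt] at this
      have : ((4 * t + 1 : ℕ) : ℝ) ≤ q := by exact_mod_cast this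
      push_cast at this; linarith
    rcases Nat.eq_zero_or_pos t with h0 | h0
    · have : Q = ∅ := by rw [← Finset.card_eq_zero]; omega
      subst this; simp
    have h0' : (0:ℝ) < t := by exact_mod_cast h0
    calc _ ≤ ∑ q ∈ Q, 1 / (4 * (t:ℝ)) := Finset.sum_le_sum fun q hq => one_div_le_one_div_of_le (by positivity) (hb q hq)
      _ = 1/4 := by rw [Finset.sum_const, hQc, nsmul_eq_mul]; field_simp
      _ ≤ _ := le_rfl
  · rw [hQc, ht]; push_cast
    have : (0:ℝ) ≤ t0 := Nat.cast_nonneg _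
    linarith

end

section
lemma exp_of_prod (Q : Finset ℕ) (hQ : ∀ q ∈ Q, q.Prime) (M : ℕ) (hM : ∀ q ∈ Q, q - 1 ∣ M)
    (L : ℕ) (hL : L = ∏ q ∈ Q, q) (u : (ZMod L)ˣ) : u ^ M = 1 := by
  have hL0 : 0 < L := hL ▸ Finset.prod_pos fun p hp => (hQ p hp).pos
  have : NeZero L := ⟨hL0.ne'⟩
  ext
  rw [Units.val_pow_eq_pow_val, Units.val_one]
  rw [← sub_eq_zero]
  set x : ZMod L := (u : ZMod L) ^ M - 1 with hx
  have hdiv : L ∣ x.val := by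
    conv_lhs => rw [hL]
    refine Finset.prod_primes_dvd _ (fun q hq => (hQ q hq).prime) fun q hq => ?_
    have : Fact q.Prime := ⟨hQ q hq⟩
    have hqL : q ∣ L := hL ▸ Finset.dvd_prod_of_mem (fun q => q) hq
    have h0 : ZMod.castHom hqL (ZMod q) x = 0 := by
      rw [hx, map_sub, map_pow, map_one]
      obtain ⟨c, hc⟩ := hM q hq
      have hne : ZMod.castHom hqL (ZMod q) (u : ZMod L) ≠ 0 := 
        ((Units.isUnit u).map (ZMod.castHom hqL (ZMod q))).ne_zero
      rw [hc, pow_mul, ZMod.pow_card_sub_one_eq_one hne, one_pow, sub_self]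
    rw [← ZMod.natCast_zmod_val x, map_natCast, ZMod.natCast_eq_zero_iff] at h0
    exact h0
  rw [← ZMod.natCast_zmod_val x, ZMod.natCast_eq_zero_iff]
  exact hdiv

lemma count_aux (j A B t M : ℕ) {C s N : ℝ} (hM1 : (1:ℝ) ≤ M) (ht1' : (1:ℝ) ≤ t) (hC0 : 0 < C) (hs1 : 1 ≤ s)
    (hMs : (M:ℝ) ^ (j+1) ≤ s) 
    (hsD : C * 2 ^ A * (2 ^ j * 5 ^ (j+1) + B + 2) * (t:ℝ) ^ (2 * A + 2 * j + 2) ≤ s)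
    (hNlow : s * s ≤ C * 2 ^ A * (t:ℝ) ^ (2 * A) * N) : 
    (2:ℝ) ^ j * ((M:ℝ) * (4 * (t:ℝ) ^ 2) + 1) ^ (j+1) + t + B + 1 ≤ N := by
  have hpos : 0 < C * 2 ^ A * (t:ℝ) ^ (2 * A) := by positivity
  refine le_of_mul_le_mul_left (le_trans ?_ hNlow) hpos
  have h1 : ((M:ℝ) * (4 * (t:ℝ) ^ 2) + 1) ^ (j+1) ≤ 5 ^ (j+1) * (t:ℝ) ^ (2*j+2) * s := by
    calc ((M:ℝ) * (4 * (t:ℝ) ^ 2) + 1) ^ (j+1) ≤ (5 * (t:ℝ) ^ 2 * M) ^ (j+1) := by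
          apply pow_le_pow_left₀ (by positivity)
          nlinarith [one_le_mul_of_one_le_of_one_le hM1 (one_le_pow₀ ht1' : 1 ≤ (t:ℝ)^2)]
      _ = 5 ^ (j+1) * (t:ℝ) ^ (2*j+2) * (M:ℝ) ^ (j+1) := by
          rw [mul_pow, mul_pow, ← pow_mul, show 2 * (j+1) = 2 * j + 2 by ring]
      _ ≤ _ := by gcongr
  have h2 : (t:ℝ) + B + 1 ≤ (B + 2) * (t:ℝ) ^ (2*j+2) * s := by
    have h3 : (t:ℝ) ≤ (t:ℝ) ^ (2*j+2) := le_self_pow₀ ht1' (by omega)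
    have hB : (0:ℝ) ≤ B := Nat.cast_nonneg _
    have h4 : (t:ℝ) + B + 1 ≤ (B + 2) * t := by nlinarith
    calc (t:ℝ) + B + 1 ≤ (B + 2) * t * 1 := by linarith
      _ ≤ _ := by gcongr
  have h3 : (2:ℝ) ^ j * ((M:ℝ) * (4 * (t:ℝ) ^ 2) + 1) ^ (j+1) ≤ (2:ℝ) ^ j * (5 ^ (j+1) * (t:ℝ) ^ (2*j+2) * s) := 
    mul_le_mul_of_nonneg_left h1 (by positivity)
  calc _ ≤ C * 2 ^ A * (t:ℝ) ^ (2 * A) * ((2:ℝ) ^ j * (5 ^ (j+1) * (t:ℝ) ^ (2*j+2) * s) + (B + 2) * (t:ℝ) ^ (2*j+2) * s) := by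
        refine mul_le_mul_of_nonneg_left ?_ hpos.le
        linarith
    _ = C * 2 ^ A * (2 ^ j * 5 ^ (j+1) + B + 2) * (t:ℝ) ^ (2 * A + 2 * j + 2) * s := by
        rw [show 2 * A + 2 * j + 2 = 2 * A + (2 * j + 2) by ring, pow_add (t:ℝ) (2 * A)]; ring
    _ ≤ s * s := by gcongr

set_option maxHeartbeats 1000000 in
lemma step3 (j : ℕ) (hj : 1 ≤ j) (B : ℕ) : ∃ n, B < n ∧ IsCarmichael n ∧ ∃ m : ℕ, n.primeFactors.card = m ^ j := by
  classical
  obtain ⟨C, hC, A, hP⟩ := prachar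
  set D : ℝ := C * 2 ^ A * (2 ^ j * 5 ^ (j+1) + B + 2) with hD
  set a := 2 * A + 2 * j + 2 with ha
  obtain ⟨t0, ht0⟩ := Filter.eventually_atTop.mp ((poly_le_two_pow (D ^ 2) (2 * a)).and (Filter.eventually_ge_atTop 2))
  set H : ℝ := 4 * (j + 1) with hH
  have hj0 : (0:ℝ) ≤ j := Nat.cast_nonneg _
  have hH1 : 1 ≤ H := by rw [hH]; linarith
  obtain ⟨M, hM, Q, hQ, hsum, hc1, hc2⟩ := step2 H hH1 t0
  obtain ⟨ht, ht2⟩ := ht0 _ hc2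
  obtain ⟨Q', hQ', m, hm, hcop, hmain⟩ := hP Q (fun q hq => (hQ q hq).1) hsum
  set t := Q.card with htd
  have hQp : ∀ q ∈ Q', q.Prime := fun q hq => (hQ q (hQ' hq)).1
  set R := ∏ p ∈ Q, p with hR
  have hR0 : 0 < R := Finset.prod_pos fun p hp => (hQ p hp).1.pos
  set L := ∏ p ∈ Q', p with hL
  have hL0 : 0 < L := Finset.prod_pos fun p hp => (hQp p hp).pos
  have hLR : L ≤ R := Nat.le_of_dvd hR0 (Finset.prod_dvd_prod_of_subset _ _ _ hQ')
  set l := Real.log (4 * M) with hl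
  have hl1 : 1 ≤ l := log4_ge hM
  have hM1 : (1:ℝ) ≤ M := by exact_mod_cast hM
  have ht2' : (2:ℝ) ≤ t := by exact_mod_cast ht2
  have hlt : l ≤ t := by nlinarith
  have hexpl : Real.exp l = 4 * M := by rw [hl, Real.exp_log (by linarith)]
  -- size of R
  have hRexp : 4 * (R:ℝ) ≤ Real.exp (2 * (t:ℝ) ^ 2) := by
    have h1 : R ≤ (M + 1) ^ t := by
      rw [hR, htd]
      refine Finset.prod_le_pow_card _ _ _ fun q hq => ?_
      have := Nat.le_of_dvd hM (hQ q hq).2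
      omega
    have h2 : (R:ℝ) ≤ (Real.exp t) ^ t := by
      calc (R:ℝ) ≤ ((M:ℝ) + 1) ^ t := by exact_mod_cast h1
        _ ≤ (Real.exp t) ^ t := by
          gcongr
          calc (M:ℝ) + 1 ≤ Real.exp l := by rw [hexpl]; linarith
            _ ≤ _ := by gcongr
    have h3 : (4:ℝ) ≤ (Real.exp t) ^ t := by
      have : (2:ℝ) ≤ Real.exp t := by linarith [Real.add_one_le_exp (t:ℝ)]
      calc (4:ℝ) = 2 ^ 2 := by norm_num
        _ ≤ 2 ^ t := pow_le_pow_right₀ (by norm_num) ht2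
        _ ≤ _ := by gcongr
    calc 4 * (R:ℝ) ≤ (Real.exp t) ^ t * (Real.exp t) ^ t := by gcongr
      _ = _ := by rw [← Real.exp_nat_mul, ← Real.exp_add]; congr 1; ring
  have hlogR : Real.log (4 * R) ≤ 2 * (t:ℝ) ^ 2 := by
    rw [Real.log_le_iff_le_exp (by have : (0:ℝ) < R := by exact_mod_cast hR0
                                   positivity)]
    exact hRexp
  have hlogR0 : 0 ≤ Real.log (4 * R) := by linarith [log4_ge hR0]
  set N : ℝ := ((L.divisors.filter (fun d => (d * m + 1).Prime)).card : ℝ) with hN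
  have hN0 : 0 ≤ N := Nat.cast_nonneg _
  have hC0 : 0 < C := by linarith
  have hNlow : (2:ℝ) ^ t ≤ C * 2 ^ A * (t:ℝ) ^ (2 * A) * N := by
    have h1 : 1 ≤ Real.log (4 * R * m) := by
      have := log4_ge (Nat.mul_pos hR0 hm)
      push_cast at this
      rwa [← mul_assoc] at this
    calc (2:ℝ) ^ t = 2 ^ t * 1 := (mul_one _).symm
      _ ≤ 2 ^ t * Real.log (4 * R * m) := by gcongr
      _ ≤ _ := hmain
      _ ≤ C * (2 * (t:ℝ) ^ 2) ^ A * N := by gcongr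
      _ = _ := by rw [mul_pow, ← pow_mul]; ring
  -- M power
  set s := Real.sqrt ((2:ℝ) ^ t) with hs
  have hs2 : s * s = 2 ^ t := Real.mul_self_sqrt (by positivity)
  have hs1 : 1 ≤ s := by
    rw [hs, Real.one_le_sqrt]; exact one_le_pow₀ (by norm_num)
  have hMs : (M:ℝ) ^ (j+1) ≤ s := by
    rw [hs]
    apply Real.le_sqrt_of_sq_le
    calc ((M:ℝ) ^ (j+1)) ^ 2 ≤ (Real.exp l ^ (j+1)) ^ 2 := by
          have hMe : (M:ℝ) ≤ Real.exp l := by rw [hexpl]; linarith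
          gcongr
      _ = Real.exp (2 * (j+1) * l) := by
          rw [← pow_mul, ← Real.exp_nat_mul]; push_cast; congr 1; ring
      _ ≤ Real.exp (t * Real.log 2) := by
          refine Real.exp_le_exp.mpr ?_
          have := Real.log_two_gt_d9
          rw [hH] at hc1
          nlinarith
      _ = _ := by rw [mul_comm, Real.exp_mul, Real.exp_log (by norm_num), Real.rpow_natCast]
  have hD0 : 0 < D := by positivity
  have hsD : D * (t:ℝ) ^ a ≤ s := by
    rw [hs]
    apply Real.le_sqrt_of_sq_le
    rw [mul_pow, ← pow_mul, mul_comm a 2]; exact ht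
  have ht1' : (1:ℝ) ≤ t := by linarith
  have hcount := count_aux j A B t M hM1 ht1' hC0 hs1 hMs hsD (hs2.le.trans hNlow)
  have he : L.totient ≤ 2 ^ (4 * t ^ 2) := by
    have : (L.totient:ℝ) ≤ 2 ^ (4 * t ^ 2) := by
      calc (L.totient:ℝ) ≤ R := by exact_mod_cast (Nat.totient_le L).trans hLR
        _ ≤ 4 * R := by have : (0:ℝ) ≤ R := Nat.cast_nonneg _
                        linarith
        _ ≤ _ := hRexp
        _ ≤ Real.exp ((4 * t ^ 2 : ℕ) * Real.log 2) := by
            refine Real.exp_le_exp.mpr ?_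
            have := Real.log_two_gt_d9
            push_cast
            nlinarith [sq_nonneg (t:ℝ)]
        _ = _ := by rw [mul_comm, Real.exp_mul, Real.exp_log (by norm_num), Real.rpow_natCast]
    exact_mod_cast this
  set P2 := (L.divisors.filter (fun d => (d * m + 1).Prime)).image (fun d => d * m + 1) with hP2
  have hP2c : (P2.card : ℝ) = N := by
    rw [hP2, Finset.card_image_of_injective _ (by
      intro a b h
      simp only [add_left_inj] at h
      exact Nat.eq_of_mul_eq_mul_right hm h)]
  set P := P2 \ (Q' ∪ Finset.range (B+1)) with hPd
  have hPprop : ∀ p ∈ P, p.Prime ∧ p.Coprime L ∧ ∃ d, d ∣ L ∧ p = d * m + 1 := by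
    intro p hp
    obtain ⟨h1, h2⟩ := Finset.mem_sdiff.mp hp
    obtain ⟨d, hd, rfl⟩ := Finset.mem_image.mp h1
    rw [Finset.mem_filter] at hd
    refine ⟨hd.2, ?_, d, Nat.dvd_of_mem_divisors hd.1, rfl⟩
    refine Nat.Coprime.prod_right fun q hq => ?_
    rw [Nat.coprime_primes hd.2 (hQp q hq)]
    rintro rfl
    exact h2 (Finset.mem_union_left _ hq)
  have hPc : 2 ^ j * (M * (4 * t ^ 2) + 1) ^ (j+1) ≤ P.card := by
    have h1 := Finset.le_card_sdiff (Q' ∪ Finset.range (B+1)) P2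
    have h2 := Finset.card_union_le Q' (Finset.range (B+1))
    have h3 := Finset.card_le_card hQ'
    rw [Finset.card_range] at h2
    have h4 : 2 ^ j * (M * (4 * t ^ 2) + 1) ^ (j+1) + t + B + 1 ≤ P2.card := by
      rw [← hP2c] at hcount
      exact_mod_cast hcount
    rw [← hPd] at h1
    omega
  obtain ⟨S, hS, ⟨p, hp⟩, hcar, hpow⟩ := carm_from_primes hL0 hj hM hcop
    (exp_of_prod Q' hQp M (fun q hq => (hQ q (hQ' hq)).2) L hL) he P hPprop hPc
  refine ⟨_, ?_, hcar, hpow⟩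
  have hpB : B < p := by
    have := (Finset.mem_sdiff.mp (hS hp)).2
    rw [Finset.mem_union, Finset.mem_range] at this
    omega
  refine hpB.trans_le (Nat.le_of_dvd ?_ (Finset.dvd_prod_of_mem _ hp))
  exact Finset.prod_pos fun q hq => (hPprop q (hS hq)).1.pos

end

theorem infinite_carmichael_power_omega (j : ℕ) (hj : 2 ≤ j) :
    {n : ℕ | IsCarmichael n ∧ ∃ m : ℕ, n.primeFactors.card = m ^ j}.Infinite := by
  refine Set.infinite_of_not_bddAbove ?_
  rintro ⟨B, hB⟩
  obtain ⟨n, hn, h⟩ := step3 j (by omega) B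
  exact absurd (hB h) (by omega)
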